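/- arXiv:2409.17677 — 3 statements merged into one kernel-verified Lean document; each statement's English description precedes it below -/
import Mathlib

section
/- For any finite subset X of ℝ^d, there exists a unit vector v ∈ ℝ^d such that for all x, x' ∈ X: (1/|X|²)·√(8/(πd))·‖x − x'‖₂ ≤ |v^T(x − x')| ≤ ‖x − x'‖₂. -/
open Real
open scoped RealInnerProductSpace

namespace ProjScalar

open MeasureTheory

lemma gamma_half (x : ℝ) (hx : 0 < x) :
    Real.Gamma (x + 1 / 2) ≤ Real.Gamma x * √x := by
  have h := Real.Gamma_mul_add_mul_le_rpow_Gamma_mul_rpow_Gamma (s := x) (t := x + 1)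
    (a := 1 / 2) (b := 1 / 2) hx (by linarith) (by norm_num) (by norm_num) (by norm_num)
  have e : (1 / 2 * x + 1 / 2 * (x + 1) : ℝ) = x + 1 / 2 := by ring
  have hG := Real.Gamma_pos_of_pos hx
  rw [e, Real.Gamma_add_one hx.ne', ← Real.sqrt_eq_rpow, ← Real.sqrt_eq_rpow,
    Real.sqrt_mul hx.le] at h
  calc _ ≤ _ := h
    _ = (√(Real.Gamma x) * √(Real.Gamma x)) * √x := by ring
    _ = _ := by rw [Real.mul_self_sqrt hG.le]

lemma const_ineq (m : ℕ) :
    √(8 / (π * ((m + 1 : ℕ) : ℝ))) * (√π ^ m / Real.Gamma ((m : ℝ) / 2 + 1)) <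
      √π ^ (m + 1) / Real.Gamma (((m + 1 : ℕ) : ℝ) / 2 + 1) := by
  have hx : (0 : ℝ) < (m : ℝ) / 2 + 1 := by positivity
  have e : ((m + 1 : ℕ) : ℝ) / 2 + 1 = ((m : ℝ) / 2 + 1) + 1 / 2 := by push_cast; ring
  have hg := gamma_half _ hx
  have ha := Real.Gamma_pos_of_pos hx
  have hb : 0 < Real.Gamma (((m : ℝ) / 2 + 1) + 1 / 2) := Real.Gamma_pos_of_pos (by positivity)
  rw [e]
  have hpi := Real.pi_gt_three
  have hm : (0 : ℝ) ≤ m := m.cast_nonneg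
  have hk : √(8 / (π * ((m + 1 : ℕ) : ℝ))) * √((m : ℝ) / 2 + 1) < √π := by
    rw [← Real.sqrt_mul (by positivity)]
    apply Real.sqrt_lt_sqrt (by positivity)
    rw [div_mul_eq_mul_div, div_lt_iff₀ (by positivity)]
    push_cast
    have : 9 < π * π := by nlinarith
    nlinarith
  have hp : 0 < √π ^ m := by positivity
  generalize Real.Gamma (((m : ℝ) / 2 + 1) + 1 / 2) = b at *
  generalize Real.Gamma ((m : ℝ) / 2 + 1) = a at *
  rw [← mul_div_assoc, div_lt_div_iff₀ ha hb, pow_succ]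
  have hK : 0 ≤ √(8 / (π * ((m + 1 : ℕ) : ℝ))) := Real.sqrt_nonneg _
  generalize √(8 / (π * ((m + 1 : ℕ) : ℝ))) = K at *
  have : K * b < √π * a := by
    calc K * b ≤ K * (a * √((m : ℝ) / 2 + 1)) := by gcongr
      _ = (K * √((m : ℝ) / 2 + 1)) * a := by ring
      _ < _ := by gcongr
  calc K * √π ^ m * b = √π ^ m * (K * b) := by ring
    _ < √π ^ m * (√π * a) := by gcongr
    _ = _ := by ring

lemma vol_ball (m : ℕ) : volume (Metric.ball (0 : EuclideanSpace ℝ (Fin m)) 1) =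
    ENNReal.ofReal (√π ^ m / Real.Gamma ((m : ℝ) / 2 + 1)) := by
  rcases m with _ | m
  · rw [volume_euclideanSpace_eq_dirac]
    simp
  · rw [EuclideanSpace.volume_ball]
    simp

lemma slab (m : ℕ) (u : EuclideanSpace ℝ (Fin (m + 1))) (hu : ‖u‖ = 1) (ε : ℝ) :
    volume {x : EuclideanSpace ℝ (Fin (m + 1)) | ‖x‖ < 1 ∧ |⟪u, x⟫| ≤ ε} ≤
      ENNReal.ofReal (2 * ε) * volume (Metric.ball (0 : EuclideanSpace ℝ (Fin m)) 1) := by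
  obtain ⟨b, hb⟩ := Orthonormal.exists_orthonormalBasis_extension_of_card_eq (𝕜 := ℝ)
    (E := EuclideanSpace ℝ (Fin (m + 1))) (ι := Fin (m + 1)) (by simp)
    (v := fun _ => u) (s := {0}) (by
      rw [orthonormal_iff_ite]
      rintro ⟨i, hi⟩ ⟨j, hj⟩
      simp only [Set.mem_singleton_iff] at hi hj
      subst hi hj
      simp [hu])
  have hb0 : b 0 = u := hb 0 (by simp)
  have mp1 := b.measurePreserving_repr
  have mp2 := PiLp.volume_preserving_ofLp (Fin (m + 1))
  have mp3 := volume_preserving_piFinSuccAbove (fun _ : Fin (m + 1) => ℝ) 0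
  have mp4 := (MeasurePreserving.id (volume : Measure ℝ)).prod (PiLp.volume_preserving_toLp (Fin m))
  have mp := mp4.comp (mp3.comp (mp2.comp mp1))
  have hms : MeasurableSet
      (Set.Icc (-ε) ε ×ˢ Metric.ball (0 : EuclideanSpace ℝ (Fin m)) 1) :=
    measurableSet_Icc.prod measurableSet_ball
  have key := mp.measure_preimage hms.nullMeasurableSet
  rw [Measure.prod_prod, Real.volume_Icc, show ε - -ε = 2 * ε by ring] at key
  rw [← key]
  apply measure_mono
  rintro x ⟨hx1, hx2⟩
  have h0 : b.repr x 0 = ⟪u, x⟫ := by rw [b.repr_apply_apply, hb0]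
  have hn : ‖b.repr x‖ = ‖x‖ := b.repr.norm_map x
  simp only [Set.mem_preimage, Set.mem_prod, Function.comp_apply, Prod.map, id,
    mem_ball_zero_iff, MeasurableEquiv.piFinSuccAbove_apply, Fin.insertNthEquiv_zero]
  constructor
  · rw [Set.mem_Icc, ← abs_le]
    rw [← h0] at hx2
    exact hx2
  · refine lt_of_le_of_lt ?_ hx1
    rw [← hn, EuclideanSpace.norm_eq, EuclideanSpace.norm_eq]
    apply Real.sqrt_le_sqrt
    rw [Fin.sum_univ_succ (n := m)]
    refine le_add_of_nonneg_of_le (by positivity) (le_of_eq ?_)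
    rfl

lemma slab' (m : ℕ) (w : EuclideanSpace ℝ (Fin (m + 1))) (hw : w ≠ 0) (ε : ℝ) :
    volume {x : EuclideanSpace ℝ (Fin (m + 1)) | ‖x‖ < 1 ∧ |⟪w, x⟫| ≤ ε * ‖w‖} ≤
      ENNReal.ofReal (2 * ε) * volume (Metric.ball (0 : EuclideanSpace ℝ (Fin m)) 1) := by
  have hp : 0 < ‖w‖ := norm_pos_iff.mpr hw
  refine le_trans (measure_mono ?_) (slab m (‖w‖⁻¹ • w) (by
    rw [norm_smul, norm_inv, norm_norm, inv_mul_cancel₀ hp.ne']) ε)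
  rintro x ⟨h1, h2⟩
  refine ⟨h1, ?_⟩
  rw [real_inner_smul_left, abs_mul, abs_of_pos (inv_pos.mpr hp), inv_mul_le_iff₀ hp]
  linarith

end ProjScalar

open ProjScalar MeasureTheory in
/-- Key existence statement. -/
lemma ProjScalar.exists_pt (m : ℕ) (X : Finset (EuclideanSpace ℝ (Fin (m + 1))))
    (hX : 2 ≤ X.card) :
    ∃ y : EuclideanSpace ℝ (Fin (m + 1)), ‖y‖ < 1 ∧ ∀ x ∈ X, ∀ x' ∈ X, x ≠ x' →
      (1 / (X.card : ℝ) ^ 2) * √(8 / (π * ((m + 1 : ℕ) : ℝ))) * ‖x - x'‖ < |⟪x - x', y⟫| := by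
  classical
  set ε := (1 / (X.card : ℝ) ^ 2) * √(8 / (π * ((m + 1 : ℕ) : ℝ))) with hε
  let w : Sym2 (EuclideanSpace ℝ (Fin (m + 1))) → EuclideanSpace ℝ (Fin (m + 1)) :=
    fun z => (Quot.out z).1 - (Quot.out z).2
  let S := X.offDiag.image (fun p => s(p.1, p.2))
  have hS : S.card = X.card.choose 2 := Sym2.card_image_offDiag X
  have hw : ∀ x x', w s(x, x') = x - x' ∨ w s(x, x') = -(x - x') := by
    intro x x'
    have h : s((Quot.out s(x, x')).1, (Quot.out s(x, x')).2) = s(x, x') := Quot.out_eq _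
    rw [Sym2.eq_iff] at h
    rcases h with ⟨h1, h2⟩ | ⟨h1, h2⟩
    · left; simp only [w, h1, h2]
    · right; simp only [w, h1, h2]; abel
  have hw0 : ∀ z ∈ S, w z ≠ 0 := by
    intro z hz
    simp only [S, Finset.mem_image, Finset.mem_offDiag] at hz
    obtain ⟨⟨x, x'⟩, ⟨_, _, hne⟩, rfl⟩ := hz
    have := sub_ne_zero.mpr hne
    rcases hw x x' with h | h
    · rw [h]; exact this
    · rw [h]; exact neg_ne_zero.mpr this
  have hlt : volume (⋃ z ∈ S, {x | ‖x‖ < 1 ∧ |⟪w z, x⟫| ≤ ε * ‖w z‖}) <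
      volume (Metric.ball (0 : EuclideanSpace ℝ (Fin (m + 1))) 1) := by
    calc _ ≤ ∑ z ∈ S, volume {x | ‖x‖ < 1 ∧ |⟪w z, x⟫| ≤ ε * ‖w z‖} :=
          measure_biUnion_finset_le _ _
      _ ≤ ∑ z ∈ S, ENNReal.ofReal (2 * ε) *
            volume (Metric.ball (0 : EuclideanSpace ℝ (Fin m)) 1) :=
          Finset.sum_le_sum fun z hz => slab' m _ (hw0 z hz) ε
      _ = ENNReal.ofReal ((X.card.choose 2 : ℕ) * (2 * ε *
            (√π ^ m / Real.Gamma ((m : ℝ) / 2 + 1)))) := by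
          rw [Finset.sum_const, hS, vol_ball, ← ENNReal.ofReal_mul (by positivity), nsmul_eq_mul,
            ENNReal.ofReal_mul (Nat.cast_nonneg (X.card.choose 2)), ENNReal.ofReal_natCast]
      _ < _ := by
          rw [vol_ball]
          have hc := const_ineq m
          have hG : 0 < Real.Gamma ((m : ℝ) / 2 + 1) := Real.Gamma_pos_of_pos (by positivity)
          have hc0 : 0 ≤ √(8 / (π * ((m + 1 : ℕ) : ℝ))) *
            (√π ^ m / Real.Gamma ((m : ℝ) / 2 + 1)) := by positivity
          refine (ENNReal.ofReal_lt_ofReal_iff (lt_of_le_of_lt hc0 hc)).mpr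
            (lt_of_le_of_lt ?_ hc)
          rw [hε, Nat.cast_choose_two]
          have hn : (2 : ℝ) ≤ X.card := by exact_mod_cast hX
          generalize (X.card : ℝ) = n at *
          calc _ = ((n - 1) / n) * (√(8 / (π * ((m + 1 : ℕ) : ℝ))) *
                (√π ^ m / Real.Gamma ((m : ℝ) / 2 + 1))) := by field_simp
            _ ≤ 1 * _ := by
              gcongr
              rw [div_le_one (by linarith)]; linarith
            _ = _ := one_mul _
  obtain ⟨y, hy, hyn⟩ : ∃ y ∈ Metric.ball (0 : EuclideanSpace ℝ (Fin (m + 1))) 1,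
      y ∉ ⋃ z ∈ S, {x | ‖x‖ < 1 ∧ |⟪w z, x⟫| ≤ ε * ‖w z‖} := by
    by_contra! h
    exact absurd (measure_mono h) (not_le.mpr hlt)
  rw [mem_ball_zero_iff] at hy
  refine ⟨y, hy, fun x hx x' hx' hne => ?_⟩
  by_contra! hcon
  apply hyn
  simp only [Set.mem_iUnion]
  refine ⟨s(x, x'), ?_, hy, ?_⟩
  · simp only [S, Finset.mem_image, Finset.mem_offDiag]
    exact ⟨(x, x'), ⟨hx, hx', hne⟩, rfl⟩
  · rcases hw x x' with h | h
    · rw [h]; exact hcon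
    · rw [h, inner_neg_left, abs_neg, norm_neg]; exact hcon

/-- For any finite subset X of ℝ^d, there is a unit vector v such that
(1/|X|²)·√(8/(πd))·‖x − x'‖ ≤ |⟪v, x − x'⟫| ≤ ‖x − x'‖ for all x, x' ∈ X. -/
theorem projection_into_scalar
    (d : ℕ) (hd : 0 < d) (X : Finset (EuclideanSpace ℝ (Fin d))) :
    ∃ v : EuclideanSpace ℝ (Fin d), ‖v‖ = 1 ∧
      ∀ x ∈ X, ∀ x' ∈ X,
        (1 / (X.card : ℝ) ^ 2) * Real.sqrt (8 / (π * d)) * ‖x - x'‖ ≤ |⟪v, x - x'⟫| ∧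
        |⟪v, x - x'⟫| ≤ ‖x - x'‖ := by
  obtain ⟨m, rfl⟩ : ∃ m, d = m + 1 := ⟨d - 1, by omega⟩
  have upper : ∀ v : EuclideanSpace ℝ (Fin (m + 1)), ‖v‖ = 1 → ∀ z, |⟪v, z⟫| ≤ ‖z‖ := by
    intro v hv z
    have := abs_real_inner_le_norm v z
    rwa [hv, one_mul] at this
  by_cases hX : 2 ≤ X.card
  · obtain ⟨y, hy, h⟩ := ProjScalar.exists_pt m X hX
    have hy0 : 0 < ‖y‖ := by
      obtain ⟨a, ha, b, hb, hab⟩ := Finset.one_lt_card.mp hX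
      rw [norm_pos_iff]
      rintro rfl
      have h1 := h a ha b hb hab
      rw [inner_zero_right, abs_zero] at h1
      exact absurd h1 (not_lt.mpr (by positivity))
    have hv : ‖‖y‖⁻¹ • y‖ = 1 := by
      rw [norm_smul, norm_inv, norm_norm, inv_mul_cancel₀ hy0.ne']
    refine ⟨‖y‖⁻¹ • y, hv, fun x hx x' hx' => ⟨?_, upper _ hv _⟩⟩
    by_cases hne : x = x'
    · subst hne; simp
    · refine (h x hx x' hx' hne).le.trans ?_
      rw [real_inner_smul_left, abs_mul, abs_of_pos (inv_pos.mpr hy0), real_inner_comm]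
      exact le_mul_of_one_le_left (abs_nonneg _) ((one_le_inv₀ hy0).mpr hy.le)
  · refine ⟨EuclideanSpace.single 0 1, by simp, fun x hx x' hx' => ⟨?_, upper _ (by simp) _⟩⟩
    have : x = x' := Finset.card_le_one.mp (by omega) x hx x' hx'
    subst this; simp
end

section
/- Suppose W ≤ M and let P_1,...,P_M be real polynomials of degree at most D in W variables. Then the number of distinct sign vectors (sgn(P_1(a)),...,sgn(P_M(a))) attained as a ranges over ℝ^W is at most (8eMD/W)^W. -/
namespace GJ

open Finset Filter Topology

/-- multi-indices of total weight at most `s` -/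
def degSet (ι : Type) [Fintype ι] [DecidableEq ι] (s : ℕ) : Finset (ι → ℕ) :=
  (Fintype.piFinset fun _ => Finset.range (s + 1)).filter fun a => ∑ i, a i ≤ s

lemma mem_degSet {ι : Type} [Fintype ι] [DecidableEq ι] {s : ℕ} {a : ι → ℕ} :
    a ∈ degSet ι s ↔ ∑ i, a i ≤ s := by
  simp only [degSet, mem_filter, Fintype.mem_piFinset, mem_range, and_iff_right_iff_imp]
  intro h i
  have := Finset.single_le_sum (f := a) (fun _ _ => Nat.zero_le _) (mem_univ i)
  omega

lemma card_degSet (ι : Type) [Fintype ι] [DecidableEq ι] (s : ℕ) :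
    (degSet ι s).card = (s + Fintype.card ι).choose (Fintype.card ι) := by
  have e : {a // a ∈ degSet ι s} ≃ {P : Option ι → ℕ // ∑ i, P i = s} :=
    { toFun := fun a => ⟨fun o => o.elim (s - ∑ i, a.1 i) a.1, by
        have := mem_degSet.1 a.2
        rw [Fintype.sum_option]; simp; omega⟩
      invFun := fun P => ⟨fun i => P.1 (some i), by
        rw [mem_degSet]
        have := P.2
        rw [Fintype.sum_option] at this; omega⟩
      left_inv := fun a => by simp
      right_inv := fun P => by
        have := P.2
        rw [Fintype.sum_option] at this
        ext o
        cases o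
        · simp; omega
        · simp }
  have h1 := Fintype.card_congr (e.trans (Sym.equivNatSumOfFintype (Option ι) s).symm)
  rw [Fintype.card_coe, Sym.card_sym_eq_choose, Fintype.card_option] at h1
  rw [h1, show Fintype.card ι + 1 + s - 1 = s + Fintype.card ι by omega]
  exact Nat.choose_symm_add

section bez
variable {σ τ : Type} [Fintype σ] [Fintype τ] [DecidableEq σ] [DecidableEq τ]

/-- monomial function -/
def mono (m : (σ → ℕ) × (τ → ℕ)) : (σ → ℝ) × (τ → ℝ) → ℝ :=
  fun z => (∏ i, z.1 i ^ m.1 i) * ∏ j, z.2 j ^ m.2 j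

/-- span of monomial functions of bidegree at most `(a, b)` -/
def V (σ τ : Type) [Fintype σ] [Fintype τ] [DecidableEq σ] [DecidableEq τ] (a b : ℕ) :
    Submodule ℝ ((σ → ℝ) × (τ → ℝ) → ℝ) :=
  Submodule.span ℝ (mono '' (↑(degSet σ a ×ˢ degSet τ b) : Set _))

lemma mono_mem {a b : ℕ} {m : (σ → ℕ) × (τ → ℕ)} (h1 : ∑ i, m.1 i ≤ a) (h2 : ∑ i, m.2 i ≤ b) :
    mono m ∈ V σ τ a b := by
  apply Submodule.subset_span
  refine ⟨m, ?_, rfl⟩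
  simp [mem_degSet, h1, h2]

lemma V_mono {a b a' b' : ℕ} (h1 : a ≤ a') (h2 : b ≤ b') : V σ τ a b ≤ V σ τ a' b' := by
  rw [V, Submodule.span_le]
  rintro _ ⟨m, hm, rfl⟩
  simp only [coe_product, Set.mem_prod, mem_coe, mem_degSet] at hm
  exact mono_mem (hm.1.trans h1) (hm.2.trans h2)

lemma V_mul {a b a' b' : ℕ} {f g : (σ → ℝ) × (τ → ℝ) → ℝ} (hf : f ∈ V σ τ a b)
    (hg : g ∈ V σ τ a' b') : f * g ∈ V σ τ (a + a') (b + b') := by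
  have h := Submodule.mul_mem_mul hf hg
  rw [V, V, Submodule.span_mul_span] at h
  refine (Submodule.span_le.2 ?_) h
  rintro _ ⟨_, ⟨m, hm, rfl⟩, _, ⟨m', hm', rfl⟩, rfl⟩
  simp only [coe_product, Set.mem_prod, mem_coe, mem_degSet] at hm hm'
  have : mono m * mono m' = (mono (m + m') : (σ → ℝ) × (τ → ℝ) → ℝ) := by
    ext z
    simp only [mono, Pi.mul_apply, Prod.fst_add, Prod.snd_add, Pi.add_apply, pow_add,
      prod_mul_distrib]
    ring
  simp only [this]
  apply mono_mem
  · simp only [Prod.fst_add, Pi.add_apply, sum_add_distrib]; omega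
  · simp only [Prod.snd_add, Pi.add_apply, sum_add_distrib]; omega

lemma V_one {a b : ℕ} : (1 : (σ → ℝ) × (τ → ℝ) → ℝ) ∈ V σ τ a b := by
  have : (1 : (σ → ℝ) × (τ → ℝ) → ℝ) = mono 0 := by ext z; simp [mono]
  rw [this]
  apply mono_mem <;> simp

lemma V_const {a b : ℕ} (c : ℝ) : (fun _ => c : (σ → ℝ) × (τ → ℝ) → ℝ) ∈ V σ τ a b := by
  have := (V σ τ a b).smul_mem c V_one
  convert this using 1
  ext z; simp

lemma V_fst (i : σ) : (fun z => z.1 i : (σ → ℝ) × (τ → ℝ) → ℝ) ∈ V σ τ 1 0 := by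
  have : (fun z => z.1 i : (σ → ℝ) × (τ → ℝ) → ℝ) = mono (Pi.single i 1, 0) := by
    ext z
    simp only [mono, Pi.zero_apply, pow_zero, prod_const_one, mul_one]
    rw [Finset.prod_eq_single i] <;> simp +contextual
  rw [this]
  apply mono_mem <;> simp

lemma V_snd (i : τ) : (fun z => z.2 i : (σ → ℝ) × (τ → ℝ) → ℝ) ∈ V σ τ 0 1 := by
  have : (fun z => z.2 i : (σ → ℝ) × (τ → ℝ) → ℝ) = mono (0, Pi.single i 1) := by
    ext z
    simp only [mono, Pi.zero_apply, pow_zero, prod_const_one, one_mul]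
    rw [Finset.prod_eq_single i] <;> simp +contextual
  rw [this]
  apply mono_mem <;> simp

lemma V_pow {a b : ℕ} {f : (σ → ℝ) × (τ → ℝ) → ℝ} (hf : f ∈ V σ τ a b) (n : ℕ) :
    f ^ n ∈ V σ τ (n * a) (n * b) := by
  induction n with
  | zero => simpa using V_one
  | succ n ih =>
    rw [pow_succ, Nat.succ_mul, Nat.succ_mul]
    exact V_mul ih hf

lemma V_prod {κ : Type} (s : Finset κ) (a b : κ → ℕ) (f : κ → (σ → ℝ) × (τ → ℝ) → ℝ)
    (hf : ∀ k ∈ s, f k ∈ V σ τ (a k) (b k)) :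
    ∏ k ∈ s, f k ∈ V σ τ (∑ k ∈ s, a k) (∑ k ∈ s, b k) := by
  classical
  induction s using Finset.induction_on with
  | empty => simpa using V_one
  | insert k s hk ih =>
    rw [prod_insert hk, sum_insert hk, sum_insert hk]
    exact V_mul (hf _ (mem_insert_self _ _)) (ih fun j hj => hf _ (mem_insert_of_mem hj))

lemma V_poly {D : ℕ} (p : MvPolynomial σ ℝ) (hp : p.totalDegree ≤ D) :
    (fun z => MvPolynomial.eval z.1 p : (σ → ℝ) × (τ → ℝ) → ℝ) ∈ V σ τ D 0 := by
  have : (fun z => MvPolynomial.eval z.1 p : (σ → ℝ) × (τ → ℝ) → ℝ)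
      = ∑ m ∈ p.support, p.coeff m • mono (⇑m, 0) := by
    ext z
    rw [MvPolynomial.eval_eq']
    simp [mono]
  rw [this]
  refine Submodule.sum_mem _ fun m hm => Submodule.smul_mem _ _ (mono_mem ?_ (by simp))
  have := MvPolynomial.le_totalDegree hm
  rw [Finsupp.sum_fintype _ _ (by simp)] at this
  exact this.trans hp

lemma V_finrank (a b : ℕ) : Module.finrank ℝ (V σ τ a b) ≤
    (a + Fintype.card σ).choose (Fintype.card σ) * (b + Fintype.card τ).choose (Fintype.card τ) := by
  classical
  have h := finrank_span_finset_le_card (R := ℝ)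
    ((degSet σ a ×ˢ degSet τ b).image (mono : _ → (σ → ℝ) × (τ → ℝ) → ℝ))
  rw [coe_image] at h
  refine h.trans (card_image_le.trans ?_)
  rw [card_product, card_degSet, card_degSet]

instance (a b : ℕ) : FiniteDimensional ℝ (V σ τ a b) :=
  FiniteDimensional.span_of_finite ℝ ((Finset.finite_toSet _).image _)

/-- square distance function to `w` -/
def sqd (w : (σ → ℝ) × (τ → ℝ)) : (σ → ℝ) × (τ → ℝ) → ℝ :=
  fun z => ∑ i, (z.1 i - w.1 i) ^ 2 + ∑ j, (z.2 j - w.2 j) ^ 2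

lemma sqd_mem (w : (σ → ℝ) × (τ → ℝ)) : sqd w ∈ V σ τ 2 2 := by
  have : sqd w = ∑ i, ((fun z : (σ → ℝ) × (τ → ℝ) => z.1 i) - fun _ => w.1 i) ^ 2
      + ∑ j, ((fun z : (σ → ℝ) × (τ → ℝ) => z.2 j) - fun _ => w.2 j) ^ 2 := by
    ext z; simp [sqd]
  rw [this]
  refine Submodule.add_mem _ (Submodule.sum_mem _ fun i _ => ?_) (Submodule.sum_mem _ fun i _ => ?_)
  · exact V_mono (by norm_num) (by norm_num) (V_pow (Submodule.sub_mem _ (V_fst i) (V_const _)) 2)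
  · exact V_mono (by norm_num) (by norm_num) (V_pow (Submodule.sub_mem _ (V_snd i) (V_const _)) 2)

lemma sqd_eq_zero {w z : (σ → ℝ) × (τ → ℝ)} : sqd w z = 0 ↔ z = w := by
  constructor
  · intro h
    have h1 : 0 ≤ ∑ i, (z.1 i - w.1 i) ^ 2 := sum_nonneg fun _ _ => sq_nonneg _
    have h2 : 0 ≤ ∑ i, (z.2 i - w.2 i) ^ 2 := sum_nonneg fun _ _ => sq_nonneg _
    unfold sqd at h
    have e1 : ∑ i, (z.1 i - w.1 i) ^ 2 = 0 := by linarith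
    have e2 : ∑ i, (z.2 i - w.2 i) ^ 2 = 0 := by linarith
    rw [sum_eq_zero_iff_of_nonneg fun _ _ => sq_nonneg _] at e1 e2
    ext i
    · have := e1 i (mem_univ _); rw [sq_eq_zero_iff, sub_eq_zero] at this; exact this
    · have := e2 i (mem_univ _); rw [sq_eq_zero_iff, sub_eq_zero] at this; exact this
  · rintro rfl; simp [sqd]

lemma continuous_of_mem_V {a b : ℕ} {f : (σ → ℝ) × (τ → ℝ) → ℝ} (hf : f ∈ V σ τ a b) :
    Continuous f := by
  refine Submodule.span_induction (p := fun f _ => Continuous f) ?_ ?_ ?_ ?_ hf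
  · rintro _ ⟨m, _, rfl⟩
    unfold mono
    fun_prop
  · exact continuous_const
  · intro _ _ _ _ h1 h2; exact h1.add h2
  · intro _ _ _ h; exact h.const_smul _

lemma lin_indep {ι : Type} [Fintype ι] [DecidableEq ι]
    (F : ι → (σ → ℝ) × (τ → ℝ) → ℝ) (Z : Finset ((σ → ℝ) × (τ → ℝ)))
    (h : (σ → ℝ) × (τ → ℝ) → (σ → ℝ) × (τ → ℝ) → ℝ)
    (hc : ∀ z ∈ Z, Continuous (h z)) (h1 : ∀ z ∈ Z, h z z ≠ 0)
    (h0 : ∀ z ∈ Z, ∀ w ∈ Z, z ≠ w → h z w = 0)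
    (hF0 : ∀ z ∈ Z, ∀ i, F i z = 0)
    (hnd : ∀ z ∈ Z, ∀ y : ι → ℝ, ∃ v, ∀ i, HasDerivAt (fun t : ℝ => F i (z + t • v)) (y i) 0)
    (s : ℕ) :
    LinearIndependent ℝ (fun q : {q // q ∈ Z ×ˢ degSet ι s} =>
      h q.1.1 * ∏ i, F i ^ q.1.2 i) := by
  rw [Fintype.linearIndependent_iff]
  intro g hg
  let c : (σ → ℝ) × (τ → ℝ) → (ι → ℕ) → ℝ := fun z a =>
    if hq : (z, a) ∈ Z ×ˢ degSet ι s then g ⟨(z, a), hq⟩ else 0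
  have hsum : ∀ w, ∑ z ∈ Z, ∑ a ∈ degSet ι s, c z a * (h z w * ∏ i, F i w ^ a i) = 0 := by
    intro w
    have := congrFun hg w
    rw [← Finset.sum_product', ← Finset.sum_coe_sort]
    simp only [Finset.sum_apply, Pi.smul_apply, Pi.mul_apply, Finset.prod_apply, Pi.pow_apply,
      smul_eq_mul, Pi.zero_apply] at this
    rw [← this]
    refine Finset.sum_congr rfl fun q _ => ?_
    simp only [c]
    rw [dif_pos q.2]
  have key : ∀ m : ℕ, ∀ z ∈ Z, ∀ a ∈ degSet ι s, ∑ i, a i = m → c z a = 0 := by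
    intro m
    induction m using Nat.strong_induction_on with
    | _ m ih =>
    intro z0 hz0
    have hy : ∀ y : ι → ℝ, ∑ a ∈ (degSet ι s).filter (fun a => ∑ i, a i = m),
        c z0 a * ∏ i, y i ^ a i = 0 := by
      intro y
      obtain ⟨v, hv⟩ := hnd z0 hz0 y
      have hlimF : ∀ i, Tendsto (fun t : ℝ => F i (z0 + t • v) / t) (𝓝[≠] 0) (𝓝 (y i)) := by
        intro i
        have := (hv i).tendsto_slope_zero
        simp only [zero_add, zero_smul, add_zero, hF0 z0 hz0 i, sub_zero, smul_eq_mul] at this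
        refine this.congr fun t => ?_
        ring
      have hlimh : ∀ z ∈ Z, Tendsto (fun t : ℝ => h z (z0 + t • v)) (𝓝[≠] 0) (𝓝 (h z z0)) := by
        intro z hz
        have hcz := hc z hz
        have : Continuous fun t : ℝ => h z (z0 + t • v) := by fun_prop
        have := (this.tendsto 0).mono_left (nhdsWithin_le_nhds (s := {0}ᶜ))
        simpa using this
      have hterm : ∀ z ∈ Z, ∀ a ∈ degSet ι s, Tendsto (fun t : ℝ =>
          c z a * (h z (z0 + t • v) * ∏ i, F i (z0 + t • v) ^ a i) / t ^ m) (𝓝[≠] 0)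
          (𝓝 (if ∑ i, a i = m then c z a * (h z z0 * ∏ i, y i ^ a i) else 0)) := by
        intro z hz a ha
        rcases lt_or_ge (∑ i, a i) m with hlt | hge
        · rw [ih _ hlt z hz a ha rfl]
          simp
        · have hT : Tendsto (fun t : ℝ => t ^ (∑ i, a i - m)) (𝓝[≠] 0)
              (𝓝 (if ∑ i, a i = m then 1 else 0)) := by
            have h2 : Continuous fun t : ℝ => t ^ (∑ i, a i - m) := by fun_prop
            have h3 := (h2.tendsto 0).mono_left (nhdsWithin_le_nhds (s := {0}ᶜ))
            convert h3 using 2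
            split_ifs with h4
            · simp [h4]
            · rw [zero_pow]; omega
          have h5 := (((tendsto_const_nhds (x := c z a)).mul (hlimh z hz)).mul
            (tendsto_finsetProd (univ : Finset ι) fun i _ => (hlimF i).pow (a i))).mul hT
          have h6 : (if ∑ i, a i = m then c z a * (h z z0 * ∏ i, y i ^ a i) else 0)
            = c z a * h z z0 * (∏ i, y i ^ a i) * (if ∑ i, a i = m then 1 else 0) := by
            split_ifs <;> ring
          rw [h6]
          refine h5.congr' ?_
          filter_upwards [self_mem_nhdsWithin] with t ht
          have ht : t ≠ 0 := ht
          simp only [div_pow, prod_div_distrib, prod_pow_eq_pow_sum]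
          have : t ^ (∑ i, a i) = t ^ (∑ i, a i - m) * t ^ m := by
            rw [← pow_add]; congr 1; omega
          rw [this]
          field_simp
      have hall := tendsto_finsetSum Z fun z hz => tendsto_finsetSum (degSet ι s) fun a ha =>
        hterm z hz a ha
      have hz : Tendsto (fun t : ℝ => ∑ z ∈ Z, ∑ a ∈ degSet ι s,
          c z a * (h z (z0 + t • v) * ∏ i, F i (z0 + t • v) ^ a i) / t ^ m) (𝓝[≠] 0) (𝓝 0) := by
        simp only [← Finset.sum_div, hsum, zero_div]
        exact tendsto_const_nhds
      have heq := tendsto_nhds_unique hall hz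
      rw [Finset.sum_eq_single z0] at heq
      · rw [← Finset.sum_filter] at heq
        have : h z0 z0 * ∑ a ∈ (degSet ι s).filter (fun a => ∑ i, a i = m),
            c z0 a * ∏ i, y i ^ a i = 0 := by
          rw [← heq, mul_sum]
          refine sum_congr rfl fun a _ => by ring
        exact (mul_eq_zero.1 this).resolve_left (h1 z0 hz0)
      · intro z hz hne
        refine sum_eq_zero fun a _ => ?_
        rw [h0 z hz z0 hz0 hne]
        simp
      · intro hn; exact absurd hz0 hn
    intro a ha ham
    let p : MvPolynomial ι ℝ := ∑ a ∈ (degSet ι s).filter (fun a => ∑ i, a i = m),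
      MvPolynomial.monomial (Finsupp.equivFunOnFinite.symm a) (c z0 a)
    have hp : p = 0 := by
      apply MvPolynomial.funext
      intro y
      simp only [p, map_sum, map_zero]
      rw [← hy y]
      refine sum_congr rfl fun a _ => ?_
      rw [MvPolynomial.eval_monomial, Finsupp.prod_fintype _ _ (by simp)]
      simp
    have hcoef : p.coeff (Finsupp.equivFunOnFinite.symm a) = c z0 a := by
      simp only [p, MvPolynomial.coeff_sum, MvPolynomial.coeff_monomial,
        EmbeddingLike.apply_eq_iff_eq]
      rw [Finset.sum_ite_eq' , if_pos]
      simp [ha, ham]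
    rw [← hcoef, hp]; simp
  rintro ⟨⟨z, a⟩, hq⟩
  have hq' := mem_product.1 hq
  have := key _ z hq'.1 a hq'.2 rfl
  simpa only [c, dif_pos hq] using this

lemma limit_ineq (N A B W k n e D : ℕ) (hn : n = W + k)
    (h : ∀ s : ℕ, N * A * s ^ n ≤ B * ((s * D + e) ^ W * (s + e) ^ k)) :
    N * A ≤ B * D ^ W := by
  have h1 : Tendsto (fun s : ℕ => (e : ℝ) / s) atTop (𝓝 0) := tendsto_const_div_atTop_nhds_zero_nat _
  have h2 : Tendsto (fun s : ℕ => (B : ℝ) * (((D : ℝ) + e / s) ^ W * (1 + (e : ℝ) / s) ^ k)) atTop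
      (𝓝 ((B : ℝ) * (((D : ℝ) + 0) ^ W * (1 + 0) ^ k))) :=
    tendsto_const_nhds.mul (((tendsto_const_nhds.add h1).pow _).mul
      ((tendsto_const_nhds.add h1).pow _))
  have h3 : ∀ᶠ s : ℕ in atTop, ((N * A : ℕ) : ℝ) ≤
      (B : ℝ) * (((D : ℝ) + e / s) ^ W * (1 + (e : ℝ) / s) ^ k) := by
    filter_upwards [eventually_gt_atTop 0] with s hs
    have hs' : (0 : ℝ) < s := by exact_mod_cast hs
    have h4 : ((N * A * s ^ n : ℕ) : ℝ) ≤ ((B * ((s * D + e) ^ W * (s + e) ^ k) : ℕ) : ℝ) := by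
      exact_mod_cast h s
    push_cast at h4 ⊢
    have e1 : (D : ℝ) + e / s = (s * D + e) / s := by field_simp
    have e2 : (1 : ℝ) + e / s = (s + e) / s := by field_simp
    rw [e1, e2, div_pow, div_pow, div_mul_div_comm, ← pow_add, ← hn, ← mul_div_assoc,
      le_div_iff₀ (by positivity)]
    exact h4
  have h5 := ge_of_tendsto h2 h3
  simp only [add_zero, one_pow, mul_one] at h5
  exact_mod_cast h5

lemma bezout {ι : Type} [Fintype ι] [DecidableEq ι]
    (hι : Fintype.card ι = Fintype.card σ + Fintype.card τ) (D : ℕ)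
    (F : ι → (σ → ℝ) × (τ → ℝ) → ℝ) (hF : ∀ i, F i ∈ V σ τ D 1)
    (Z : Finset ((σ → ℝ) × (τ → ℝ)))
    (hF0 : ∀ z ∈ Z, ∀ i, F i z = 0)
    (hnd : ∀ z ∈ Z, ∀ y : ι → ℝ, ∃ v, ∀ i, HasDerivAt (fun t : ℝ => F i (z + t • v)) (y i) 0) :
    Z.card ≤ (Fintype.card σ + Fintype.card τ).choose (Fintype.card τ) * D ^ Fintype.card σ := by
  classical
  set W := Fintype.card σ with hW
  set k := Fintype.card τ with hk
  let e := Z.card * 2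
  let h : (σ → ℝ) × (τ → ℝ) → (σ → ℝ) × (τ → ℝ) → ℝ := fun z => ∏ w ∈ Z.erase z, sqd w
  have hV : ∀ z, h z ∈ V σ τ e e := by
    intro z
    have := V_prod (Z.erase z) (fun _ => 2) (fun _ => 2) sqd fun w _ => sqd_mem w
    refine V_mono ?_ ?_ this <;>
    · rw [sum_const, smul_eq_mul]
      exact Nat.mul_le_mul_right _ (card_le_card (erase_subset _ _))
  have hcount : ∀ s, Z.card * (s + (W + k)).choose (W + k) ≤
      (e + s * D + W).choose W * (e + s + k).choose k := by
    intro s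
    have hli := lin_indep F Z h (fun z _ => continuous_of_mem_V (hV z))
      (fun z _ => by
        simp only [h, Finset.prod_apply, prod_ne_zero_iff]
        intro w hw hz
        rw [sqd_eq_zero] at hz
        exact (mem_erase.1 hw).1 hz.symm)
      (fun z _ w hw hzw => by
        simp only [h, Finset.prod_apply]
        exact prod_eq_zero (mem_erase.2 ⟨hzw.symm, hw⟩) (sqd_eq_zero.2 rfl)) hF0 hnd s
    have hmem : ∀ q : {q // q ∈ Z ×ˢ degSet ι s},
        h q.1.1 * ∏ i, F i ^ q.1.2 i ∈ V σ τ (e + s * D) (e + s) := by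
      intro q
      have hq := mem_degSet.1 (mem_product.1 q.2).2
      have := V_prod univ (fun i => q.1.2 i * D) (fun i => q.1.2 i * 1) (fun i => F i ^ q.1.2 i)
        fun i _ => V_pow (hF i) _
      refine V_mul (hV _) (V_mono ?_ ?_ this)
      · rw [← sum_mul]; exact Nat.mul_le_mul_right _ hq
      · simpa using hq
    have hli' : LinearIndependent ℝ (fun q : {q // q ∈ Z ×ˢ degSet ι s} =>
        (⟨_, hmem q⟩ : V σ τ (e + s * D) (e + s))) :=
      LinearIndependent.of_comp (V σ τ (e + s * D) (e + s)).subtype hli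
    have := hli'.fintype_card_le_finrank
    rw [Fintype.card_coe, card_product, card_degSet, hι] at this
    exact this.trans (V_finrank _ _)
  have hfin : Z.card * (W.factorial * k.factorial) ≤ (W + k).factorial * D ^ W := by
    refine limit_ineq Z.card (W.factorial * k.factorial) (W + k).factorial W k (W + k)
      (e + W + k) D rfl fun s => ?_
    have b1 : s ^ (W + k) ≤ (W + k).factorial * (s + (W + k)).choose (W + k) := by
      rw [← Nat.ascFactorial_eq_factorial_mul_choose]
      exact (Nat.pow_le_pow_left (Nat.le_succ s) _).trans (Nat.pow_succ_le_ascFactorial _ _)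
    have b2 : ∀ a r : ℕ, r.factorial * (a + r).choose r ≤ (a + r) ^ r := by
      intro a r
      rw [← Nat.descFactorial_eq_factorial_mul_choose]
      exact Nat.descFactorial_le_pow _ _
    calc Z.card * (W.factorial * k.factorial) * s ^ (W + k)
        ≤ Z.card * (W.factorial * k.factorial) *
          ((W + k).factorial * (s + (W + k)).choose (W + k)) := Nat.mul_le_mul_left _ b1
      _ = (W + k).factorial * (W.factorial * k.factorial) *
          (Z.card * (s + (W + k)).choose (W + k)) := by ring
      _ ≤ (W + k).factorial * (W.factorial * k.factorial) *
          ((e + s * D + W).choose W * (e + s + k).choose k) := Nat.mul_le_mul_left _ (hcount s)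
      _ = (W + k).factorial * ((W.factorial * (e + s * D + W).choose W) *
          (k.factorial * (e + s + k).choose k)) := by ring
      _ ≤ (W + k).factorial * ((e + s * D + W) ^ W * (e + s + k) ^ k) := by
          gcongr <;> apply b2
      _ ≤ _ := by
          exact Nat.mul_le_mul_left _ (Nat.mul_le_mul (Nat.pow_le_pow_left (by omega) _)
            (Nat.pow_le_pow_left (by omega) _))
  have hch := Nat.add_choose_mul_factorial_mul_factorial W k
  have hpos : 0 < W.factorial * k.factorial := by positivity
  refine Nat.le_of_mul_le_mul_right ?_ hpos
  calc _ ≤ _ := hfin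
    _ = (W + k).choose k * W.factorial * k.factorial * D ^ W := by rw [hch]
    _ = _ := by ring

end bez
end GJ

namespace GJ

open Finset Filter Topology MeasureTheory

lemma totalDegree_pderiv_le' {σ : Type} (i : σ) (p : MvPolynomial σ ℝ) :
    (MvPolynomial.pderiv i p).totalDegree ≤ p.totalDegree := by
  classical
  conv_lhs => rw [p.as_sum, map_sum]
  refine MvPolynomial.totalDegree_finsetSum_le fun m hm => ?_
  rw [MvPolynomial.pderiv_monomial]
  refine (MvPolynomial.totalDegree_monomial_le _ _).trans ?_
  refine le_trans ?_ (MvPolynomial.le_totalDegree hm)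
  have hle : m - Finsupp.single i 1 ≤ m := tsub_le_self
  exact Finsupp.degree_mono hle

lemma hasDerivAt_eval {W : ℕ} (p : MvPolynomial (Fin W) ℝ) (x v : Fin W → ℝ) :
    HasDerivAt (fun t : ℝ => MvPolynomial.eval (x + t • v) p)
      (∑ l, MvPolynomial.eval x (MvPolynomial.pderiv l p) * v l) 0 := by
  induction p using MvPolynomial.induction_on with
  | C a => simpa using hasDerivAt_const (0 : ℝ) a
  | add p q hp hq =>
    simp only [map_add, add_mul, sum_add_distrib]
    exact hp.add hq
  | mul_X p i hp =>
    have h1 : HasDerivAt (fun t : ℝ => x i + t * v i) (v i) 0 := by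
      simpa using ((hasDerivAt_id (0 : ℝ)).mul_const (v i)).const_add (x i)
    have h2 := hp.mul h1
    have h3 : ∑ l, MvPolynomial.eval x (MvPolynomial.pderiv l (p * MvPolynomial.X i)) * v l
      = (∑ l, MvPolynomial.eval x (MvPolynomial.pderiv l p) * v l) * (x i + 0 * v i)
        + MvPolynomial.eval (x + (0 : ℝ) • v) p * v i := by
      simp only [Derivation.leibniz, smul_eq_mul, map_add, map_mul, MvPolynomial.eval_X,
        MvPolynomial.pderiv_X, add_mul, sum_add_distrib, zero_smul, add_zero, zero_mul, sum_mul]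
      rw [add_comm]
      congr 1
      · refine sum_congr rfl fun l _ => by ring
      · rw [sum_eq_single i]
        · simp
        · intro l _ hl
          simp [hl.symm]
        · simp
    rw [h3]
    refine h2.congr_of_eventuallyEq (Eventually.of_forall fun t => ?_)
    simp

@[fun_prop]
lemma differentiable_eval {W : ℕ} {E : Type*} [NormedAddCommGroup E] [NormedSpace ℝ E]
    (f : E → Fin W → ℝ) (hf : Differentiable ℝ f) (p : MvPolynomial (Fin W) ℝ) :
    Differentiable ℝ fun y : E => MvPolynomial.eval (f y) p := by
  induction p using MvPolynomial.induction_on with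
  | C a => simp
  | add p q hp hq => simp only [map_add]; exact hp.add hq
  | mul_X p i hp =>
    simp only [map_mul, MvPolynomial.eval_X]
    exact hp.mul (differentiable_pi.1 hf i)

variable {W M : ℕ}

/-- parameter space -/
abbrev PS (W M : ℕ) : Type := (Fin W → ℝ) × (Fin M → ℝ) × (Fin M → Fin W → ℝ)

/-- linearly perturbed polynomial -/
noncomputable def Q (P : Fin M → MvPolynomial (Fin W) ℝ) (b : Fin M → Fin W → ℝ) (j : Fin M)
    (x : Fin W → ℝ) : ℝ := MvPolynomial.eval x (P j) + ∑ l, b j l * x l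

/-- its gradient -/
noncomputable def G (P : Fin M → MvPolynomial (Fin W) ℝ) (b : Fin M → Fin W → ℝ) (j : Fin M)
    (x : Fin W → ℝ) (l : Fin W) : ℝ := MvPolynomial.eval x (MvPolynomial.pderiv l (P j)) + b j l

/-- sign attached to a set -/
noncomputable def sg (T : Finset (Fin M)) (j : Fin M) : ℝ := if j ∈ T then 1 else -1

lemma sg_mul_self (T : Finset (Fin M)) (j : Fin M) : sg T j * sg T j = 1 := by
  unfold sg; split_ifs <;> norm_num

/-- the Lagrange system -/
noncomputable def Psi (P : Fin M → MvPolynomial (Fin W) ℝ) (J T : Finset (Fin M)) (y : PS W M) :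
    PS W M :=
  (fun l => y.1 l - ∑ j ∈ J, y.2.1 j * G P y.2.2 j y.1 l,
   fun j => if j ∈ J then sg T j * Q P y.2.2 j y.1 else y.2.1 j,
   y.2.2)

/-- auxiliary perturbation parameter -/
noncomputable def bb (P : Fin M → MvPolynomial (Fin W) ℝ) (J : Finset (Fin M)) (j0 : Fin M)
    (y : PS W M) : Fin M → Fin W → ℝ := fun j l =>
  if j = j0 then - MvPolynomial.eval y.1 (MvPolynomial.pderiv l (P j0))
    - ∑ j ∈ J.erase j0, y.2.1 j * G P y.2.2 j y.1 l else y.2.2 j l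

/-- the dependency system -/
noncomputable def Tht (P : Fin M → MvPolynomial (Fin W) ℝ) (J T : Finset (Fin M)) (j0 : Fin M)
    (y : PS W M) : PS W M :=
  (y.2.2 j0, fun j => if j ∈ J then sg T j * Q P (bb P J j0 y) j y.1 else y.2.1 j, bb P J j0 y)

lemma differentiable_Psi (P : Fin M → MvPolynomial (Fin W) ℝ) (J T : Finset (Fin M)) :
    Differentiable ℝ (Psi P J T) := by
  unfold Psi
  refine Differentiable.prodMk ?_ (Differentiable.prodMk ?_ (by fun_prop))
  · rw [differentiable_pi]
    intro l
    unfold G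
    fun_prop
  · rw [differentiable_pi]
    intro j
    unfold Q
    split_ifs
    · fun_prop
    · fun_prop

lemma differentiable_bb (P : Fin M → MvPolynomial (Fin W) ℝ) (J : Finset (Fin M)) (j0 : Fin M) :
    Differentiable ℝ (bb P J j0) := by
  unfold bb
  rw [differentiable_pi]
  intro j
  rw [differentiable_pi]
  intro l
  unfold G
  split_ifs
  · fun_prop
  · fun_prop

lemma differentiable_Tht (P : Fin M → MvPolynomial (Fin W) ℝ) (J T : Finset (Fin M)) (j0 : Fin M) :
    Differentiable ℝ (Tht P J T j0) := by
  have hb := differentiable_bb P J j0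
  unfold Tht
  refine Differentiable.prodMk (by fun_prop) (Differentiable.prodMk ?_ hb)
  rw [differentiable_pi]
  intro j
  unfold Q
  split_ifs
  · fun_prop
  · fun_prop

/-- genericity of a parameter -/
def Generic (P : Fin M → MvPolynomial (Fin W) ℝ) (θ : PS W M) : Prop :=
  ∀ J T : Finset (Fin M), (∀ y, Psi P J T y = θ → (fderiv ℝ (Psi P J T) y).det ≠ 0) ∧
    ∀ j0 : Fin M, ∀ y : PS W M, y.2.1 j0 = 0 → Psi P J T y ≠ θ ∧ Tht P J T j0 y ≠ θ

lemma hyper_null (j0 : Fin M) : (Measure.addHaar : Measure (PS W M)) {y | y.2.1 j0 = 0} = 0 := by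
  let L : PS W M →ₗ[ℝ] ℝ := (LinearMap.proj j0 : (Fin M → ℝ) →ₗ[ℝ] ℝ) ∘ₗ
    (LinearMap.fst ℝ (Fin M → ℝ) (Fin M → Fin W → ℝ)) ∘ₗ
    (LinearMap.snd ℝ (Fin W → ℝ) ((Fin M → ℝ) × (Fin M → Fin W → ℝ)))
  have h := Measure.addHaar_submodule (Measure.addHaar : Measure (PS W M)) (LinearMap.ker L) (by
    intro h
    have : ((0, fun _ => 1, 0) : PS W M) ∈ LinearMap.ker L := by rw [h]; trivial
    simp [L] at this)
  exact h

lemma ae_generic (P : Fin M → MvPolynomial (Fin W) ℝ) :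
    ∀ᵐ θ ∂(Measure.addHaar : Measure (PS W M)), Generic P θ := by
  unfold Generic
  simp only [ae_all_iff, eventually_and]
  intro J T
  constructor
  · have h : (Measure.addHaar : Measure (PS W M))
        (Psi P J T '' {y | (fderiv ℝ (Psi P J T) y).det = 0}) = 0 :=
      addHaar_image_eq_zero_of_det_fderivWithin_eq_zero (Measure.addHaar : Measure (PS W M))
        (fun y _ => ((differentiable_Psi P J T) y).hasFDerivAt.hasFDerivWithinAt) (fun y hy => hy)
    have h' := compl_mem_ae_iff.2 h
    filter_upwards [h'] with θ hθ y hy hd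
    exact hθ ⟨y, hd, hy⟩
  · intro j0
    have h1 := addHaar_image_eq_zero_of_differentiableOn_of_addHaar_eq_zero (Measure.addHaar : Measure (PS W M))
      ((differentiable_Psi P J T).differentiableOn) (hyper_null (W := W) j0)
    have h2 := addHaar_image_eq_zero_of_differentiableOn_of_addHaar_eq_zero (Measure.addHaar : Measure (PS W M))
      ((differentiable_Tht P J T j0).differentiableOn) (hyper_null (W := W) j0)
    filter_upwards [compl_mem_ae_iff.2 h1, compl_mem_ae_iff.2 h2] with θ hθ hθ' y hy
    exact ⟨fun h => hθ ⟨y, hy, h⟩, fun h => hθ' ⟨y, hy, h⟩⟩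

lemma exists_generic (P : Fin M → MvPolynomial (Fin W) ℝ) (U : Set (PS W M)) (hU : IsOpen U)
    (hne : U.Nonempty) : ∃ θ ∈ U, Generic P θ := by
  by_contra! h
  have hpos := hU.measure_pos (Measure.addHaar : Measure (PS W M)) hne
  have : (Measure.addHaar : Measure (PS W M)) U ≤ 0 := by
    rw [← (ae_iff.1 (ae_generic P))]
    exact measure_mono fun θ hθ => h θ hθ
  exact absurd hpos (not_lt.2 this)

lemma generic_indep (P : Fin M → MvPolynomial (Fin W) ℝ) (θ : PS W M) (hθ : Generic P θ)
    (J T : Finset (Fin M)) (x : Fin W → ℝ) (hx : ∀ j ∈ J, Q P θ.2.2 j x = sg T j * θ.2.1 j) :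
    LinearIndependent ℝ (fun j : J => G P θ.2.2 j x) := by
  rw [Fintype.linearIndependent_iff]
  intro g hg
  by_contra! hne
  obtain ⟨⟨j0, hj0⟩, hgj⟩ := hne
  let g' : Fin M → ℝ := fun j => if h : j ∈ J then g ⟨j, h⟩ else 0
  have hg' : ∀ l, ∑ j ∈ J, g' j * G P θ.2.2 j x l = 0 := by
    intro l
    have := congrFun hg l
    rw [← Finset.sum_coe_sort]
    simp only [Finset.sum_apply, Pi.smul_apply, smul_eq_mul, Pi.zero_apply] at this
    rw [← this]
    refine Finset.sum_congr rfl fun j _ => ?_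
    simp [g']
  have hj0' : g' j0 ≠ 0 := by simpa [g', hj0] using hgj
  let y : PS W M := (x, fun j => if j = j0 then 0 else if j ∈ J then g' j / g' j0 else θ.2.1 j,
    fun j => if j = j0 then θ.1 else θ.2.2 j)
  have hbb : bb P J j0 y = θ.2.2 := by
    ext j l
    unfold bb
    split_ifs with h
    · subst h
      have e1 : ∑ i ∈ J.erase j, y.2.1 i * G P y.2.2 i y.1 l
          = (∑ i ∈ J.erase j, g' i * G P θ.2.2 i x l) / g' j := by
        rw [Finset.sum_div]
        refine Finset.sum_congr rfl fun i hi => ?_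
        have hi' := mem_erase.1 hi
        simp only [y, G, if_neg hi'.1, if_pos hi'.2]
        ring
      have e2 := hg' l
      rw [← Finset.add_sum_erase _ _ hj0] at e2
      have e3 : ∑ i ∈ J.erase j, g' i * G P θ.2.2 i x l = - (g' j * G P θ.2.2 j x l) := by
        linarith
      rw [e1, e3]
      simp only [y, G]
      field_simp
      ring
    · simp [y, h]
  refine ((hθ J T).2 j0 y (by simp [y])).2 ?_
  unfold Tht
  rw [hbb]
  refine Prod.ext ?_ (Prod.ext ?_ rfl)
  · simp [y]
  · ext j
    simp only
    split_ifs with h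
    · have := hx j h
      simp only [y]
      rw [this, ← mul_assoc, sg_mul_self, one_mul]
    · have : j ≠ j0 := fun h' => h (h' ▸ hj0)
      simp [y, h, this]

/-- extend the multipliers by the remaining parameters -/
noncomputable def ext (θ : PS W M) (J : Finset (Fin M)) (z : (Fin W → ℝ) × (J → ℝ)) : PS W M :=
  (z.1, fun j => if h : j ∈ J then z.2 ⟨j, h⟩ else θ.2.1 j, θ.2.2)

/-- the system for fixed parameters -/
noncomputable def FF (P : Fin M → MvPolynomial (Fin W) ℝ) (θ : PS W M) (J T : Finset (Fin M)) :
    Fin W ⊕ J → (Fin W → ℝ) × (J → ℝ) → ℝ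
  | Sum.inl l => fun z => z.1 l - (∑ j : J, z.2 j * G P θ.2.2 j z.1 l) - θ.1 l
  | Sum.inr j => fun z => sg T j * Q P θ.2.2 j z.1 - θ.2.1 j

lemma FF_inl (P : Fin M → MvPolynomial (Fin W) ℝ) (θ : PS W M) (J T : Finset (Fin M)) (y : PS W M)
    (hy : y.2.2 = θ.2.2) (l : Fin W) :
    FF P θ J T (Sum.inl l) (y.1, fun j => y.2.1 j) = (Psi P J T y).1 l - θ.1 l := by
  simp only [FF, Psi, hy]
  rw [← Finset.sum_coe_sort J]

lemma FF_inr (P : Fin M → MvPolynomial (Fin W) ℝ) (θ : PS W M) (J T : Finset (Fin M)) (y : PS W M)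
    (hy : y.2.2 = θ.2.2) (j : J) :
    FF P θ J T (Sum.inr j) (y.1, fun j => y.2.1 j) = (Psi P J T y).2.1 j - θ.2.1 j := by
  simp only [FF, Psi, hy, j.2, if_true]

lemma Psi_ext (P : Fin M → MvPolynomial (Fin W) ℝ) (θ : PS W M) (J T : Finset (Fin M))
    (z : (Fin W → ℝ) × (J → ℝ)) (hz : ∀ i, FF P θ J T i z = 0) :
    Psi P J T (ext θ J z) = θ := by
  have he : ((ext θ J z).1, fun j : J => (ext θ J z).2.1 j) = z := by
    ext i <;> simp [ext]
  refine Prod.ext ?_ (Prod.ext ?_ rfl)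
  · ext l
    have := FF_inl P θ J T (ext θ J z) rfl l
    rw [he, hz] at this
    linarith
  · ext j
    by_cases h : j ∈ J
    · have := FF_inr P θ J T (ext θ J z) rfl ⟨j, h⟩
      rw [he, hz] at this
      simp only at this
      linarith
    · simp [Psi, ext, h]

lemma generic_ne (P : Fin M → MvPolynomial (Fin W) ℝ) (θ : PS W M) (hθ : Generic P θ)
    (J T : Finset (Fin M)) (z : (Fin W → ℝ) × (J → ℝ)) (hz : ∀ i, FF P θ J T i z = 0) (j : J) :
    z.2 j ≠ 0 := by
  intro h
  exact ((hθ J T).2 j (ext θ J z) (by simp [ext, h])).1 (Psi_ext P θ J T z hz)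

lemma FF_mem (P : Fin M → MvPolynomial (Fin W) ℝ) (D : ℕ) (hD : 1 ≤ D)
    (hdeg : ∀ i, (P i).totalDegree ≤ D) (θ : PS W M) (J T : Finset (Fin M)) (i : Fin W ⊕ J) :
    FF P θ J T i ∈ V (Fin W) J D 1 := by
  cases i with
  | inl l =>
    have e : FF P θ J T (Sum.inl l) = (fun z => z.1 l) - (∑ j : J, (fun z => z.2 j) *
        ((fun z : (Fin W → ℝ) × (J → ℝ) => MvPolynomial.eval z.1 (MvPolynomial.pderiv l (P j)))
          + fun _ => θ.2.2 j l)) - fun _ => θ.1 l := by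
      ext z; simp [FF, G]
    rw [e]
    refine Submodule.sub_mem _ (Submodule.sub_mem _ (V_mono hD (by norm_num) (V_fst l))
      (Submodule.sum_mem _ fun j _ => ?_)) (V_const _)
    have := V_mul (V_snd (σ := Fin W) j) (Submodule.add_mem _ (V_poly (τ := J) _
      ((totalDegree_pderiv_le' l (P j)).trans (hdeg j))) (V_const (θ.2.2 j l)))
    simpa using this
  | inr j =>
    have e : FF P θ J T (Sum.inr j) = sg T j • ((fun z : (Fin W → ℝ) × (J → ℝ) =>
        MvPolynomial.eval z.1 (P j)) + ∑ l, θ.2.2 j l • fun z : (Fin W → ℝ) × (J → ℝ) => z.1 l)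
        - fun _ => θ.2.1 j := by
      ext z; simp [FF, Q, mul_add]
    rw [e]
    refine Submodule.sub_mem _ (Submodule.smul_mem _ _ (Submodule.add_mem _
      (V_mono le_rfl (by norm_num) (V_poly _ (hdeg j)))
      (Submodule.sum_mem _ fun l _ => Submodule.smul_mem _ _
        (V_mono hD (by norm_num) (V_fst l))))) (V_const _)

lemma generic_count (P : Fin M → MvPolynomial (Fin W) ℝ) (D : ℕ) (hD : 1 ≤ D)
    (hdeg : ∀ i, (P i).totalDegree ≤ D) (θ : PS W M) (hθ : Generic P θ)
    (J T : Finset (Fin M)) (Z : Finset ((Fin W → ℝ) × (J → ℝ)))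
    (hZ : ∀ z ∈ Z, ∀ i, FF P θ J T i z = 0) :
    Z.card ≤ (W + J.card).choose J.card * D ^ W := by
  have := bezout (σ := Fin W) (τ := J) (ι := Fin W ⊕ J) (by simp) D (FF P θ J T)
    (FF_mem P D hD hdeg θ J T) Z hZ ?_
  · simpa using this
  intro z hz y
  have hd := (hθ J T).1 _ (Psi_ext P θ J T z (hZ z hz))
  set L := fderiv ℝ (Psi P J T) (ext θ J z) with hL
  have hLd : HasFDerivAt (Psi P J T) L (ext θ J z) :=
    ((differentiable_Psi P J T) _).hasFDerivAt
  have hsurj : Function.Surjective L := by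
    have hu : IsUnit (LinearMap.det (L : PS W M →ₗ[ℝ] PS W M)) := isUnit_iff_ne_zero.2 hd
    have h2 := (LinearMap.equivOfIsUnitDet hu).surjective
    intro w
    obtain ⟨v, hv⟩ := h2 w
    exact ⟨v, by simpa using hv⟩
  obtain ⟨v, hv⟩ := hsurj (fun l => y (Sum.inl l),
    fun j => if h : j ∈ J then y (Sum.inr ⟨j, h⟩) else 0, 0)
  have hline : HasDerivAt (fun t : ℝ => Psi P J T (ext θ J z + t • v)) (L v) 0 := by
    have h1 : HasDerivAt (fun t : ℝ => ext θ J z + t • v) v 0 := by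
      simpa using ((hasDerivAt_id (0 : ℝ)).smul_const v).const_add (ext θ J z)
    have h2 : HasFDerivAt (Psi P J T) L (ext θ J z + (0 : ℝ) • v) := by simpa using hLd
    exact h2.comp_hasDerivAt (0 : ℝ) h1
  have h22 : v.2.2 = 0 := by
    have h1 : HasDerivAt (fun t : ℝ => (Psi P J T (ext θ J z + t • v)).2.2) (L v).2.2 0 :=
      hline.snd.snd
    have h2 : HasDerivAt (fun t : ℝ => θ.2.2 + t • v.2.2) v.2.2 0 := by
      simpa using ((hasDerivAt_id (0 : ℝ)).smul_const v.2.2).const_add θ.2.2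
    have h3 := h1.unique h2
    rw [hv] at h3
    exact h3.symm
  refine ⟨(v.1, fun j => v.2.1 j), fun i => ?_⟩
  have hpt : ∀ t : ℝ, z + t • ((v.1, fun j => v.2.1 j) : (Fin W → ℝ) × (J → ℝ))
      = ((ext θ J z + t • v).1, fun j : J => (ext θ J z + t • v).2.1 j) := by
    intro t
    ext i <;> simp [ext]
  have hb : ∀ t : ℝ, (ext θ J z + t • v).2.2 = θ.2.2 := by
    intro t; simp [ext, h22]
  cases i with
  | inl l =>
    have h0 : HasDerivAt (fun t : ℝ => (Psi P J T (ext θ J z + t • v)).1) (L v).1 0 := hline.fst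
    have h1 := (hasDerivAt_pi.1 h0 l).sub_const (θ.1 l)
    rw [hv] at h1
    refine h1.congr_of_eventuallyEq (Eventually.of_forall fun t => ?_)
    simp only [hpt t]
    exact FF_inl P θ J T _ (hb t) l
  | inr j =>
    have h0 : HasDerivAt (fun t : ℝ => (Psi P J T (ext θ J z + t • v)).2.1) (L v).2.1 0 :=
      hline.snd.fst
    have h1 := (hasDerivAt_pi.1 h0 j).sub_const (θ.2.1 j)
    rw [hv] at h1
    simp only [j.2, dite_true] at h1
    refine h1.congr_of_eventuallyEq (Eventually.of_forall fun t => ?_)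
    simp only [hpt t]
    exact FF_inr P θ J T _ (hb t) j

end GJ

namespace GJ

open Finset Filter Topology MeasureTheory

variable {W M : ℕ}

lemma hasDerivAt_Q (P : Fin M → MvPolynomial (Fin W) ℝ) (b : Fin M → Fin W → ℝ) (j : Fin M)
    (x v : Fin W → ℝ) :
    HasDerivAt (fun t : ℝ => Q P b j (x + t • v)) (∑ l, G P b j x l * v l) 0 := by
  unfold Q G
  have h1 := hasDerivAt_eval (P j) x v
  have h2 : HasDerivAt (fun t : ℝ => ∑ l, b j l * (x + t • v) l) (∑ l, b j l * v l) 0 := by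
    refine HasDerivAt.fun_sum fun l _ => ?_
    have : HasDerivAt (fun t : ℝ => x l + t * v l) (v l) 0 := by
      simpa using ((hasDerivAt_id (0 : ℝ)).mul_const (v l)).const_add (x l)
    simpa using this.const_mul (b j l)
  simp only [add_mul, sum_add_distrib]
  exact h1.add h2

lemma continuous_Q (P : Fin M → MvPolynomial (Fin W) ℝ) (b : Fin M → Fin W → ℝ) (j : Fin M) :
    Continuous (Q P b j) := by
  unfold Q
  have := (P j).continuous_eval
  fun_prop

/-- closed cells -/
def Cell (P : Fin M → MvPolynomial (Fin W) ℝ) (θ : PS W M) (s : Fin M → ℝ) : Set (Fin W → ℝ) :=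
  {x | ∀ i, (s i = 1 → θ.2.1 i ≤ Q P θ.2.2 i x) ∧ (s i = -1 → Q P θ.2.2 i x ≤ - θ.2.1 i) ∧
    (s i = 0 → |Q P θ.2.2 i x| ≤ θ.2.1 i)}

lemma isClosed_Cell (P : Fin M → MvPolynomial (Fin W) ℝ) (θ : PS W M) (s : Fin M → ℝ) :
    IsClosed (Cell P θ s) := by
  have h : Cell P θ s = ⋂ i, ({x | s i = 1 → θ.2.1 i ≤ Q P θ.2.2 i x} ∩
    ({x | s i = -1 → Q P θ.2.2 i x ≤ - θ.2.1 i} ∩ {x | s i = 0 → |Q P θ.2.2 i x| ≤ θ.2.1 i})) := by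
    ext x; simp [Cell]
  rw [h]
  refine isClosed_iInter fun i => ?_
  have hc := continuous_Q P θ.2.2 i
  refine IsClosed.inter ?_ (IsClosed.inter ?_ ?_)
  · by_cases hs : s i = 1
    · simpa [hs] using isClosed_le continuous_const hc
    · simp [hs]
  · by_cases hs : s i = -1
    · simpa [hs] using isClosed_le hc continuous_const
    · simp [hs]
  · by_cases hs : s i = 0
    · simpa [hs] using isClosed_le hc.abs continuous_const
    · simp [hs]

lemma exists_min (K : Set (Fin W → ℝ)) (hK : IsClosed K) (a c : Fin W → ℝ) (ha : a ∈ K) :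
    ∃ x ∈ K, ∀ y ∈ K, ∑ l, (x l - c l) ^ 2 ≤ ∑ l, (y l - c l) ^ 2 := by
  have hcont : Continuous fun y : Fin W → ℝ => ∑ l, (y l - c l) ^ 2 := by fun_prop
  set r := ∑ l, (a l - c l) ^ 2 with hr
  have hcomp : IsCompact (K ∩ {y | ∑ l, (y l - c l) ^ 2 ≤ r}) := by
    refine Metric.isCompact_of_isClosed_isBounded
      (hK.inter (isClosed_le hcont continuous_const)) ?_
    refine (Metric.isBounded_closedBall (x := c) (r := r + 1)).subset ?_
    rintro y ⟨_, hy⟩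
    have hy : ∑ l, (y l - c l) ^ 2 ≤ r := hy
    have hr0 : 0 ≤ r := sum_nonneg fun _ _ => sq_nonneg _
    rw [Metric.mem_closedBall, dist_pi_le_iff (by linarith)]
    intro l
    have h1 := Finset.single_le_sum (f := fun l => (y l - c l) ^ 2) (fun _ _ => sq_nonneg _)
      (mem_univ l)
    rw [Real.dist_eq, abs_le]
    constructor <;> nlinarith
  obtain ⟨x, hx, hmin⟩ := hcomp.exists_isMinOn ⟨a, ha, show ∑ l, (a l - c l) ^ 2 ≤ r from le_of_eq rfl⟩ hcont.continuousOn
  refine ⟨x, hx.1, fun y hy => ?_⟩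
  by_cases h : ∑ l, (y l - c l) ^ 2 ≤ r
  · exact hmin ⟨hy, h⟩
  · exact (show ∑ l, (x l - c l) ^ 2 ≤ r from hx.2).trans (le_of_not_ge h)

lemma ev_pos {f : ℝ → ℝ} {d : ℝ} (h : HasDerivAt f d 0) (hd : 0 < d) :
    ∀ᶠ t in 𝓝[>] (0 : ℝ), f 0 < f t := by
  have h1 := h.tendsto_slope_zero_right
  filter_upwards [h1.eventually (lt_mem_nhds hd), self_mem_nhdsWithin] with t ht ht0
  have ht0 : (0 : ℝ) < t := ht0
  simp only [zero_add, smul_eq_mul] at ht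
  have := (mul_pos_iff_of_pos_left (inv_pos.2 ht0)).1 ht
  linarith

lemma ev_neg {f : ℝ → ℝ} {d : ℝ} (h : HasDerivAt f d 0) (hd : d < 0) :
    ∀ᶠ t in 𝓝[>] (0 : ℝ), f t < f 0 := by
  have := ev_pos h.neg (by linarith)
  filter_upwards [this] with t ht
  simp only [Pi.neg_apply] at ht
  linarith

lemma first_order (P : Fin M → MvPolynomial (Fin W) ℝ) (θ : PS W M) (s : Fin M → ℝ)
    (hε : ∀ i, 0 < θ.2.1 i)
    (x : Fin W → ℝ) (hx : x ∈ Cell P θ s)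
    (hmin : ∀ y ∈ Cell P θ s, ∑ l, (x l - θ.1 l) ^ 2 ≤ ∑ l, (y l - θ.1 l) ^ 2)
    (v : Fin W → ℝ)
    (h1 : ∀ i, Q P θ.2.2 i x = θ.2.1 i → s i = 1 → 0 < ∑ l, G P θ.2.2 i x l * v l)
    (h2 : ∀ i, Q P θ.2.2 i x = θ.2.1 i → s i ≠ 1 → ∑ l, G P θ.2.2 i x l * v l < 0)
    (h3 : ∀ i, Q P θ.2.2 i x = - θ.2.1 i → s i = -1 → ∑ l, G P θ.2.2 i x l * v l < 0)
    (h4 : ∀ i, Q P θ.2.2 i x = - θ.2.1 i → s i ≠ -1 → 0 < ∑ l, G P θ.2.2 i x l * v l) :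
    0 ≤ ∑ l, (x l - θ.1 l) * v l := by
  have hd := fun i => hasDerivAt_Q P θ.2.2 i x v
  have hlim : ∀ i, Tendsto (fun t : ℝ => Q P θ.2.2 i (x + t • v)) (𝓝[>] 0)
      (𝓝 (Q P θ.2.2 i x)) := by
    intro i
    have := (hd i).continuousAt.tendsto.mono_left (nhdsWithin_le_nhds (s := Set.Ioi 0))
    simpa using this
  have hcell : ∀ᶠ t in 𝓝[>] (0 : ℝ), x + t • v ∈ Cell P θ s := by
    simp only [Cell, Set.mem_ofPred_eq]
    rw [eventually_all]
    intro i
    have e0 : Q P θ.2.2 i (x + (0 : ℝ) • v) = Q P θ.2.2 i x := by simp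
    refine Eventually.and ?_ (Eventually.and ?_ ?_)
    · by_cases hs : s i = 1
      · rcases ((hx i).1 hs).lt_or_eq with hlt | heq
        · filter_upwards [(hlim i).eventually (lt_mem_nhds hlt)] with t ht _
          exact ht.le
        · filter_upwards [ev_pos (hd i) (h1 i heq.symm hs)] with t ht _
          rw [e0] at ht; linarith
      · simp [hs]
    · by_cases hs : s i = -1
      · rcases ((hx i).2.1 hs).lt_or_eq with hlt | heq
        · filter_upwards [(hlim i).eventually (gt_mem_nhds hlt)] with t ht _
          exact ht.le
        · filter_upwards [ev_neg (hd i) (h3 i heq hs)] with t ht _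
          rw [e0] at ht; linarith
      · simp [hs]
    · by_cases hs : s i = 0
      · have hab := abs_le.1 ((hx i).2.2 hs)
        have A : ∀ᶠ t in 𝓝[>] (0 : ℝ), Q P θ.2.2 i (x + t • v) ≤ θ.2.1 i := by
          rcases hab.2.lt_or_eq with hlt | heq
          · filter_upwards [(hlim i).eventually (gt_mem_nhds hlt)] with t ht
            exact ht.le
          · filter_upwards [ev_neg (hd i) (h2 i heq (by rw [hs]; norm_num))] with t ht
            rw [e0] at ht; linarith
        have B : ∀ᶠ t in 𝓝[>] (0 : ℝ), - θ.2.1 i ≤ Q P θ.2.2 i (x + t • v) := by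
          rcases hab.1.lt_or_eq with hlt | heq
          · filter_upwards [(hlim i).eventually (lt_mem_nhds hlt)] with t ht
            exact ht.le
          · filter_upwards [ev_pos (hd i) (h4 i heq.symm (by rw [hs]; norm_num))] with t ht
            rw [e0] at ht; linarith
        filter_upwards [A, B] with t hA hB _
        exact abs_le.2 ⟨hB, hA⟩
      · simp [hs]
  have hobj : HasDerivAt (fun t : ℝ => ∑ l, ((x + t • v) l - θ.1 l) ^ 2)
      (2 * ∑ l, (x l - θ.1 l) * v l) 0 := by
    rw [mul_sum]
    refine HasDerivAt.fun_sum fun l _ => ?_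
    have : HasDerivAt (fun t : ℝ => x l + t * v l - θ.1 l) (v l) 0 := by
      simpa using (((hasDerivAt_id (0 : ℝ)).mul_const (v l)).const_add (x l)).sub_const (θ.1 l)
    have h5 := this.fun_pow 2
    have e : 2 * ((x l - θ.1 l) * v l) = ((2 : ℕ) : ℝ) * (x l + 0 * v l - θ.1 l) ^ (2 - 1) * v l := by
      norm_num; ring
    rw [e]
    exact h5
  by_contra! hneg
  have h6 := ev_neg hobj (by linarith)
  obtain ⟨t, ht1, ht2⟩ := (hcell.and h6).exists
  have := hmin _ ht1
  simp only [zero_smul, add_zero] at ht2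
  linarith

lemma exists_vec {κ : Type} [Fintype κ] (f : κ → Fin W → ℝ) (hf : LinearIndependent ℝ f)
    (y : κ → ℝ) : ∃ v : Fin W → ℝ, ∀ k, ∑ l, f k l * v l = y k := by
  let B := Module.Basis.span hf
  obtain ⟨φ, hφ⟩ := LinearMap.exists_extend (B.constr ℝ y)
  refine ⟨fun l => φ (Pi.single l 1), fun k => ?_⟩
  have h1 : φ (f k) = y k := by
    have h2 : (f k) = (Submodule.span ℝ (Set.range f)).subtype (B k) := by
      simp [B, Module.Basis.span_apply]
    rw [h2, ← LinearMap.comp_apply, hφ, Module.Basis.constr_basis]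
  rw [← h1, LinearMap.pi_apply_eq_sum_univ φ (f k)]
  refine sum_congr rfl fun l _ => ?_
  rw [smul_eq_mul]
  have e : (Pi.single l 1 : Fin W → ℝ) = fun j => if l = j then 1 else 0 := by
    funext i; simp [Pi.single_apply, eq_comm]
  simp only [e]

/-- active constraints -/
noncomputable def JJ (P : Fin M → MvPolynomial (Fin W) ℝ) (θ : PS W M) (x : Fin W → ℝ) :
    Finset (Fin M) := univ.filter fun i => |Q P θ.2.2 i x| = θ.2.1 i

/-- active constraints with positive value -/
noncomputable def TT (P : Fin M → MvPolynomial (Fin W) ℝ) (θ : PS W M) (x : Fin W → ℝ) :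
    Finset (Fin M) := univ.filter fun i => Q P θ.2.2 i x = θ.2.1 i

open Classical in
/-- recover the sign vector -/
noncomputable def dec (P : Fin M → MvPolynomial (Fin W) ℝ) (θ : PS W M) (J : Finset (Fin M))
    (z : (Fin W → ℝ) × (J → ℝ)) (i : Fin M) : ℝ :=
  if h : i ∈ J then
    (if Q P θ.2.2 i z.1 = θ.2.1 i then (if 0 < z.2 ⟨i, h⟩ then 1 else 0)
      else (if z.2 ⟨i, h⟩ < 0 then -1 else 0))
  else (if θ.2.1 i < Q P θ.2.2 i z.1 then 1 else if Q P θ.2.2 i z.1 < - θ.2.1 i then -1 else 0)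

lemma multipliers (P : Fin M → MvPolynomial (Fin W) ℝ) (θ : PS W M) (hθ : Generic P θ)
    (s : Fin M → ℝ) (hs : ∀ i, s i = 1 ∨ s i = -1 ∨ s i = 0)
    (hε : ∀ i, 0 < θ.2.1 i)
    (x : Fin W → ℝ) (hx : x ∈ Cell P θ s)
    (hmin : ∀ y ∈ Cell P θ s, ∑ l, (x l - θ.1 l) ^ 2 ≤ ∑ l, (y l - θ.1 l) ^ 2) :
    (JJ P θ x).card ≤ W ∧ ∃ u : JJ P θ x → ℝ,
      (∀ i, FF P θ (JJ P θ x) (TT P θ x) i (x, u) = 0) ∧ dec P θ (JJ P θ x) (x, u) = s := by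
  classical
  set J := JJ P θ x with hJ
  set T := TT P θ x with hT
  have hact : ∀ j ∈ J, Q P θ.2.2 j x = sg T j * θ.2.1 j := by
    intro j hj
    have hj' : |Q P θ.2.2 j x| = θ.2.1 j := by simpa [hJ, JJ] using hj
    unfold sg
    split_ifs with h
    · have : Q P θ.2.2 j x = θ.2.1 j := by simpa [hT, TT] using h
      rw [this, one_mul]
    · have hne : Q P θ.2.2 j x ≠ θ.2.1 j := by simpa [hT, TT] using h
      rcases (abs_eq (hε j).le).1 hj' with h1 | h1
      · exact absurd h1 hne
      · rw [h1]; ring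
  have hind := generic_indep P θ hθ J T x hact
  refine ⟨by simpa using hind.fintype_card_le_finrank, ?_⟩
  let d : Fin M → ℝ := fun j => if Q P θ.2.2 j x = θ.2.1 j then (if s j = 1 then 1 else -1)
    else (if s j = -1 then -1 else 1)
  have hdd : ∀ j, d j * d j = 1 := by
    intro j; simp only [d]; split_ifs <;> norm_num
  have hfo : ∀ v : Fin W → ℝ, (∀ j : J, 0 < d j * ∑ l, G P θ.2.2 j x l * v l) →
      0 ≤ ∑ l, (x l - θ.1 l) * v l := by
    intro v hv
    have mem1 : ∀ i, Q P θ.2.2 i x = θ.2.1 i → i ∈ J := by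
      intro i hi; simp [hJ, JJ, hi, (hε i).le]
    have mem2 : ∀ i, Q P θ.2.2 i x = - θ.2.1 i → i ∈ J := by
      intro i hi; simp [hJ, JJ, hi, (hε i).le]
    have hne : ∀ i, Q P θ.2.2 i x = - θ.2.1 i → Q P θ.2.2 i x ≠ θ.2.1 i := by
      intro i hi h; have := hε i; linarith
    refine first_order P θ s hε x hx hmin v ?_ ?_ ?_ ?_
    · intro i hi hsi
      have := hv ⟨i, mem1 i hi⟩
      simpa [d, hi, hsi] using this
    · intro i hi hsi
      have := hv ⟨i, mem1 i hi⟩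
      simpa [d, hi, hsi] using this
    · intro i hi hsi
      have := hv ⟨i, mem2 i hi⟩
      simp only [d, if_neg (hne i hi), hsi, if_true] at this
      linarith
    · intro i hi hsi
      have := hv ⟨i, mem2 i hi⟩
      simp only [d, if_neg (hne i hi), if_neg hsi] at this
      linarith
  have hspan : (fun l => x l - θ.1 l) ∈
      Submodule.span ℝ (Set.range fun j : J => G P θ.2.2 j x) := by
    by_contra hns
    let f : Option J → Fin W → ℝ := fun o => o.elim (fun l => x l - θ.1 l) fun j => G P θ.2.2 j x
    have hf : LinearIndependent ℝ f := by
      rw [linearIndependent_option]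
      exact ⟨hind, hns⟩
    obtain ⟨v, hv⟩ := exists_vec f hf (fun o => o.elim (-1) fun j => d j)
    have h1 : ∑ l, (x l - θ.1 l) * v l = -1 := hv none
    have h2 := hfo v (fun j => by
      have h3 : ∑ l, G P θ.2.2 j x l * v l = d j := hv (some j)
      rw [h3, hdd]; norm_num)
    linarith
  obtain ⟨u, hu⟩ := (Submodule.mem_span_range_iff_exists_fun ℝ).1 hspan
  have hu' : ∀ l, ∑ j : J, u j * G P θ.2.2 j x l = x l - θ.1 l := by
    intro l
    have := congrFun hu l
    simpa using this
  have hFF : ∀ i, FF P θ J T i (x, u) = 0 := by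
    rintro (l | j)
    · simp only [FF, hu']; ring
    · simp only [FF, hact j j.2]
      rw [← mul_assoc, sg_mul_self]; ring
  refine ⟨u, hFF, ?_⟩
  have hne : ∀ j, u j ≠ 0 := generic_ne P θ hθ J T (x, u) hFF
  have hsign : ∀ j : J, 0 < d j * u j := by
    intro j
    by_contra! hle
    have hlt : d j * u j < 0 := by
      refine lt_of_le_of_ne hle (mul_ne_zero ?_ (hne j))
      intro h0
      have := hdd j
      rw [h0] at this; norm_num at this
    set A := ∑ i ∈ univ.erase j, u i * d i with hA
    let R : ℝ := (1 + |A|) / (-(d j * u j))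
    have hR : 0 < R := by
      apply div_pos
      · positivity
      · linarith
    obtain ⟨v, hv⟩ := exists_vec _ hind (fun i : J => if i = j then R * d i else d i)
    have h1 := hfo v (fun i => by
      rw [hv i]
      split_ifs
      · rw [show d i * (R * d i) = R * (d i * d i) by ring, hdd]; linarith
      · rw [hdd]; norm_num)
    have h2 : ∑ l, (x l - θ.1 l) * v l
        = ∑ i : J, u i * (if i = j then R * d i else d i) := by
      simp only [← hu', ← hv, Finset.sum_mul, Finset.mul_sum]
      rw [Finset.sum_comm]
      refine sum_congr rfl fun i _ => sum_congr rfl fun l _ => by ring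
    have h3 : ∑ i : J, u i * (if i = j then R * d i else d i) = R * (d j * u j) + A := by
      rw [← Finset.add_sum_erase _ _ (mem_univ j), hA]
      simp only [if_true]
      congr 1
      · ring
      · refine sum_congr rfl fun i hi => ?_
        rw [if_neg (mem_erase.1 hi).1]
    have h4 : R * (d j * u j) = -(1 + |A|) := by
      have h5 : -(d j * u j) ≠ 0 := (neg_pos.2 hlt).ne'
      have h6 : R * (-(d j * u j)) = 1 + |A| := div_mul_cancel₀ _ h5
      linarith
    have := le_abs_self A
    linarith
  ext i
  have hc := hx i
  have hεi := hε i
  unfold dec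
  by_cases hi : i ∈ J
  · rw [dif_pos hi]
    have hsg := hsign ⟨i, hi⟩
    simp only [d] at hsg
    have hi' : |Q P θ.2.2 i x| = θ.2.1 i := by simpa [hJ, JJ] using hi
    by_cases hq : Q P θ.2.2 i x = θ.2.1 i
    · simp only [hq, if_true] at hsg ⊢
      rcases hs i with h | h | h
      · rw [if_pos h] at hsg
        rw [if_pos (by linarith), h]
      · have := hc.2.1 h; linarith
      · rw [if_neg (by rw [h]; norm_num)] at hsg
        rw [if_neg (by linarith), h]
    · simp only [hq, if_false] at hsg ⊢
      have hq' := ((abs_eq hεi.le).1 hi').resolve_left hq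
      rcases hs i with h | h | h
      · have := hc.1 h; linarith
      · rw [if_pos h] at hsg
        rw [if_pos (by linarith), h]
      · rw [if_neg (by rw [h]; norm_num)] at hsg
        rw [if_neg (by linarith), h]
  · rw [dif_neg hi]
    have hi' : |Q P θ.2.2 i x| ≠ θ.2.1 i := by simpa [hJ, JJ] using hi
    have hq1 : Q P θ.2.2 i x ≠ θ.2.1 i := fun h => hi' (by rw [h, abs_of_pos hεi])
    have hq2 : Q P θ.2.2 i x ≠ -θ.2.1 i := fun h => hi' (by rw [h, abs_neg, abs_of_pos hεi])
    simp only
    rcases hs i with h | h | h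
    · rw [if_pos (lt_of_le_of_ne (hc.1 h) hq1.symm), h]
    · have h5 := lt_of_le_of_ne (hc.2.1 h) hq2
      rw [if_neg (by linarith), if_pos h5, h]
    · have h5 := abs_le.1 (hc.2.2 h)
      rw [if_neg (by linarith), if_neg (by linarith), h]

lemma exists_theta (P : Fin M → MvPolynomial (Fin W) ℝ) (S : Set (Fin M → ℝ)) (hS : S.Finite)
    (a : (Fin M → ℝ) → Fin W → ℝ)
    (ha : ∀ s ∈ S, ∀ i, s i = Real.sign (MvPolynomial.eval (a s) (P i))) :
    ∃ θ : PS W M, Generic P θ ∧ (∀ i, 0 < θ.2.1 i) ∧ ∀ s ∈ S, a s ∈ Cell P θ s := by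
  let U : Set (PS W M) := {θ | ∀ i, 0 < θ.2.1 i} ∩ ⋂ s ∈ S, ⋂ i,
    ({θ | s i = 1 → θ.2.1 i < Q P θ.2.2 i (a s)} ∩
    ({θ | s i = -1 → Q P θ.2.2 i (a s) < - θ.2.1 i} ∩
     {θ | s i = 0 → |Q P θ.2.2 i (a s)| < θ.2.1 i}))
  have hUo : IsOpen U := by
    refine IsOpen.inter ?_ (hS.isOpen_biInter fun s _ => isOpen_iInter_of_finite fun i => ?_)
    · simp only [Set.ofPred_forall]
      exact isOpen_iInter_of_finite fun i => isOpen_lt continuous_const (by fun_prop)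
    · have hc : Continuous fun θ : PS W M => Q P θ.2.2 i (a s) := by
        unfold Q; fun_prop
      have he : Continuous fun θ : PS W M => θ.2.1 i := by fun_prop
      refine IsOpen.inter ?_ (IsOpen.inter ?_ ?_)
      · by_cases h : s i = 1
        · simpa [h] using isOpen_lt he hc
        · simp [h]
      · by_cases h : s i = -1
        · simpa [h] using isOpen_lt hc he.neg
        · simp [h]
      · by_cases h : s i = 0
        · simpa [h] using isOpen_lt hc.abs he
        · simp [h]
  have hUne : U.Nonempty := by
    have hev : ∀ᶠ t in 𝓝[>] (0 : ℝ), ∀ s ∈ S, ∀ i, MvPolynomial.eval (a s) (P i) ≠ 0 →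
        t < |MvPolynomial.eval (a s) (P i)| := by
      rw [eventually_all_finite hS]
      intro s _
      rw [eventually_all]
      intro i
      by_cases h : MvPolynomial.eval (a s) (P i) = 0
      · simp [h]
      · filter_upwards [nhdsWithin_le_nhds (gt_mem_nhds (abs_pos.2 h))] with t ht _
        exact ht
    obtain ⟨t, ht, ht0⟩ := (hev.and self_mem_nhdsWithin).exists
    have ht0 : (0 : ℝ) < t := ht0
    refine ⟨(0, fun _ => t, 0), fun _ => ht0, ?_⟩
    simp only [Set.mem_iInter, Set.mem_inter_iff, Set.mem_ofPred_eq]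
    intro s hs i
    have hq : Q P (0 : Fin M → Fin W → ℝ) i (a s) = MvPolynomial.eval (a s) (P i) := by simp [Q]
    rw [hq, ha s hs i]
    rcases lt_trichotomy (MvPolynomial.eval (a s) (P i)) 0 with h | h | h
    · rw [Real.sign_of_neg h]
      refine ⟨by norm_num, fun _ => ?_, by norm_num⟩
      have := ht s hs i h.ne
      rw [abs_of_neg h] at this; linarith
    · rw [h, Real.sign_zero]
      refine ⟨by norm_num, by norm_num, fun _ => by simpa using ht0⟩
    · rw [Real.sign_of_pos h]
      refine ⟨fun _ => ?_, by norm_num, by norm_num⟩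
      have := ht s hs i h.ne'
      rwa [abs_of_pos h] at this
  obtain ⟨θ, hθU, hθ⟩ := exists_generic P U hUo hUne
  refine ⟨θ, hθ, hθU.1, fun s hs i => ?_⟩
  have h := hθU.2
  simp only [Set.mem_iInter, Set.mem_inter_iff, Set.mem_ofPred_eq] at h
  obtain ⟨h1, h2, h3⟩ := h s hs i
  exact ⟨fun e => (h1 e).le, fun e => (h2 e).le, fun e => (h3 e).le⟩

lemma count_nat (D : ℕ) (hD : 1 ≤ D)
    (P : Fin M → MvPolynomial (Fin W) ℝ) (hdeg : ∀ i, (P i).totalDegree ≤ D) :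
    (Set.range fun a : Fin W → ℝ =>
        fun i : Fin M => Real.sign (MvPolynomial.eval a (P i))).ncard
      ≤ ((univ : Finset (Finset (Fin M))).filter fun J => J.card ≤ W).card * (8 ^ W * D ^ W) := by
  classical
  set S := Set.range fun a : Fin W → ℝ =>
        fun i : Fin M => Real.sign (MvPolynomial.eval a (P i)) with hSdef
  have hsgn : ∀ s ∈ S, ∀ i, s i = 1 ∨ s i = -1 ∨ s i = 0 := by
    rintro _ ⟨a, rfl⟩ i
    rcases Real.sign_apply_eq (MvPolynomial.eval a (P i)) with h | h | h <;> simp [h]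
  have hS : S.Finite := by
    refine (Set.Finite.pi (t := fun _ : Fin M => ({1, -1, 0} : Set ℝ))
      (fun _ => by simp)).subset ?_
    intro s hs i _
    simpa using hsgn s hs i
  have hex : ∀ s, ∃ a : Fin W → ℝ, s ∈ S →
      ∀ i, s i = Real.sign (MvPolynomial.eval a (P i)) := by
    intro s
    by_cases h : s ∈ S
    · obtain ⟨a, rfl⟩ := h
      exact ⟨a, fun _ _ => rfl⟩
    · exact ⟨0, fun h' => absurd h' h⟩
  choose a ha using hex
  obtain ⟨θ, hθ, hε, hcell⟩ := exists_theta P S hS a ha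
  have hex2 : ∀ s, ∃ x : Fin W → ℝ, s ∈ S → ((JJ P θ x).card ≤ W ∧ ∃ u : JJ P θ x → ℝ,
      (∀ i, FF P θ (JJ P θ x) (TT P θ x) i (x, u) = 0) ∧ dec P θ (JJ P θ x) (x, u) = s) := by
    intro s
    by_cases h : s ∈ S
    · obtain ⟨x, hx, hmin⟩ := exists_min (Cell P θ s) (isClosed_Cell P θ s) (a s) θ.1 (hcell s h)
      exact ⟨x, fun _ => multipliers P θ hθ s (hsgn s h) hε x hx hmin⟩
    · exact ⟨0, fun h' => absurd h' h⟩
  choose X hX using hex2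
  rw [Set.ncard_eq_toFinset_card S hS]
  set SF := hS.toFinset with hSF
  have hmemS : ∀ s, s ∈ SF ↔ s ∈ S := fun s => by simp [hSF]
  let t : Finset (Σ _ : Finset (Fin M), Finset (Fin M)) :=
    ((univ : Finset (Finset (Fin M))).filter fun J => J.card ≤ W).sigma fun J => J.powerset
  let f : (Fin M → ℝ) → Σ _ : Finset (Fin M), Finset (Fin M) :=
    fun s => ⟨JJ P θ (X s), TT P θ (X s)⟩
  have hf : ∀ s ∈ SF, f s ∈ t := by
    intro s hs
    have h := hX s ((hmemS s).1 hs)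
    simp only [t, f, mem_sigma, mem_filter, mem_univ, true_and, mem_powerset]
    refine ⟨h.1, fun i hi => ?_⟩
    simp only [TT, JJ, mem_filter, mem_univ, true_and] at hi ⊢
    rw [hi, abs_of_pos (hε i)]
  rw [Finset.card_eq_sum_card_fiberwise hf]
  have hfib : ∀ p ∈ t, (SF.filter fun s => f s = p).card ≤ 4 ^ W * D ^ W := by
    rintro ⟨J, T⟩ hp
    have hJ : J.card ≤ W := by
      simp only [t, mem_sigma, mem_filter] at hp
      exact hp.1.2
    have hz : ∀ s, ∃ z : (Fin W → ℝ) × (J → ℝ), s ∈ SF.filter (fun s => f s = ⟨J, T⟩) →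
        (∀ i, FF P θ J T i z = 0) ∧ dec P θ J z = s := by
      intro s
      by_cases hs : s ∈ SF.filter (fun s => f s = ⟨J, T⟩)
      · have hs' := mem_filter.1 hs
        obtain ⟨_, hu⟩ := hX s ((hmemS s).1 hs'.1)
        have e := hs'.2
        simp only [f, Sigma.mk.injEq, heq_eq_eq] at e
        rw [e.1, e.2] at hu
        obtain ⟨u, h1, h2⟩ := hu
        exact ⟨(X s, u), fun _ => ⟨h1, h2⟩⟩
      · exact ⟨0, fun h => absurd h hs⟩
    choose z hz using hz
    have hinj : Set.InjOn z (SF.filter (fun s => f s = ⟨J, T⟩) : Finset _) := by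
      intro s hs s' hs' h
      rw [← (hz s hs).2, ← (hz s' hs').2, h]
    rw [← card_image_of_injOn hinj]
    refine (generic_count P D hD hdeg θ hθ J T _ ?_).trans ?_
    · intro w hw
      obtain ⟨s, hs, rfl⟩ := mem_image.1 hw
      exact (hz s hs).1
    · refine Nat.mul_le_mul_right _ ((Nat.choose_le_two_pow _ _).trans ?_)
      rw [show 4 = 2 ^ 2 by rfl, ← pow_mul]
      exact Nat.pow_le_pow_right (by norm_num) (by omega)
  refine (sum_le_sum hfib).trans ?_
  simp only [t]
  rw [sum_sigma]
  simp only [sum_const, card_powerset, smul_eq_mul]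
  rw [← smul_eq_mul (_ : ℕ) (8 ^ W * D ^ W), ← sum_const]
  refine sum_le_sum fun J hJ => ?_
  have hJ : J.card ≤ W := (mem_filter.1 hJ).2
  rw [← mul_assoc, show 8 = 2 * 4 by rfl, mul_pow]
  gcongr
  norm_num

lemma card_small (hW : 0 < W) (hWM : W ≤ M) :
    ((((univ : Finset (Finset (Fin M))).filter fun J => J.card ≤ W).card : ℕ) : ℝ)
      ≤ (Real.exp 1 * M / W) ^ W := by
  have hW' : (0 : ℝ) < W := by exact_mod_cast hW
  have hM' : (0 : ℝ) < M := by exact_mod_cast hW.trans_le hWM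
  have hq : (0 : ℝ) < (W : ℝ) / M := by positivity
  have hq1 : (W : ℝ) / M ≤ 1 := by
    rw [div_le_one hM']; exact_mod_cast hWM
  set N := (((univ : Finset (Finset (Fin M))).filter fun J => J.card ≤ W)) with hN
  have h1 : (N.card : ℝ) * ((W : ℝ) / M) ^ W ≤ (1 + (W : ℝ) / M) ^ M := by
    have h2 := Finset.sum_pow_mul_eq_add_pow ((W : ℝ) / M) 1 (univ : Finset (Fin M))
    simp only [one_pow, mul_one, powerset_univ, card_univ, Fintype.card_fin] at h2
    rw [add_comm, ← h2, ← nsmul_eq_mul, ← sum_const]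
    calc ∑ _J ∈ N, ((W : ℝ) / M) ^ W ≤ ∑ J ∈ N, ((W : ℝ) / M) ^ J.card := by
          refine sum_le_sum fun J hJ => ?_
          exact pow_le_pow_of_le_one hq.le hq1 (mem_filter.1 hJ).2
      _ ≤ _ := sum_le_sum_of_subset_of_nonneg (subset_univ _) fun _ _ _ => by positivity
  have h3 : (1 + (W : ℝ) / M) ^ M ≤ Real.exp 1 ^ W := by
    have h4 := Real.add_one_le_exp ((W : ℝ) / M)
    calc (1 + (W : ℝ) / M) ^ M ≤ Real.exp ((W : ℝ) / M) ^ M := by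
          gcongr; linarith
      _ = Real.exp 1 ^ W := by
          rw [← Real.exp_nat_mul, ← Real.exp_nat_mul]
          congr 1; field_simp
  have h5 : (Real.exp 1 * M / W) ^ W = Real.exp 1 ^ W / ((W : ℝ) / M) ^ W := by
    rw [← div_pow]; congr 1; field_simp
  rw [h5, le_div_iff₀ (by positivity)]
  exact h1.trans h3

end GJ


/-- Goldberg–Jerrum: the number of sign vectors attained by M polynomials
of degree at most D in W variables, W ≤ M, is at most (8eMD/W)^W. -/
theorem sign_pattern_count_of_polynomials
    (W M D : ℕ) (hW : 0 < W) (hWM : W ≤ M) (hD : 1 ≤ D)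
    (P : Fin M → MvPolynomial (Fin W) ℝ)
    (hdeg : ∀ i, (P i).totalDegree ≤ D) :
    ((Set.range fun a : Fin W → ℝ =>
        fun i : Fin M => Real.sign (MvPolynomial.eval a (P i))).ncard : ℝ)
      ≤ (8 * Real.exp 1 * M * D / W) ^ W := by
  have h1 := GJ.count_nat D hD P hdeg
  have h2 := GJ.card_small hW hWM
  have h3 : ((Set.range fun a : Fin W → ℝ =>
        fun i : Fin M => Real.sign (MvPolynomial.eval a (P i))).ncard : ℝ) ≤
      ((((Finset.univ : Finset (Finset (Fin M))).filter fun J => J.card ≤ W).card : ℕ) : ℝ)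
        * (8 ^ W * (D : ℝ) ^ W) := by exact_mod_cast h1
  refine h3.trans ?_
  have h4 : (8 * Real.exp 1 * M * D / W : ℝ) ^ W
      = (Real.exp 1 * M / W) ^ W * (8 ^ W * (D : ℝ) ^ W) := by
    rw [← mul_pow, ← mul_pow]; congr 1; ring
  rw [h4]
  gcongr
end

section
/- Let x_1,...,x_N ∈ ℝ^d with ‖x_i‖₂ ≤ r for all i and ‖x_i − x_j‖₂ ≥ δ for all i ≠ j. Then there exists an affine map composed with ReLU, i.e. a function F(x) = ReLU(w^T x + b) with w ∈ ℝ^d, b ∈ ℝ, such that 0 ≤ F(x_i) ≤ 10·r·N²·δ^{-1}·√(πd) for every i, and |F(x_i) − F(x_j)| ≥ 2 for every i ≠ j. -/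
open Real
open scoped RealInnerProductSpace

open MeasureTheory ProbabilityTheory in
lemma aux_small {d : ℕ} (u : EuclideanSpace ℝ (Fin d)) (hu : ‖u‖ = 1) (s : ℝ) (hs : 0 ≤ s) :
    (stdGaussian (EuclideanSpace ℝ (Fin d))).real {g | |⟪u, g⟫| ≤ s} ≤ s := by
  have h1 := IsGaussian.map_eq_gaussianReal (μ := stdGaussian (EuclideanSpace ℝ (Fin d)))
    (innerSL ℝ u)
  rw [integral_strongDual_stdGaussian, variance_dual_stdGaussian, innerSL_apply_norm, hu] at h1
  simp only [one_pow, Real.toNNReal_one] at h1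
  have h2 : {g : EuclideanSpace ℝ (Fin d) | |⟪u, g⟫| ≤ s} = (innerSL ℝ u) ⁻¹' (Set.Icc (-s) s) := by
    ext g
    simp [abs_le]
  have h3 : (stdGaussian (EuclideanSpace ℝ (Fin d))) {g | |⟪u, g⟫| ≤ s}
      = gaussianReal 0 1 (Set.Icc (-s) s) := by
    rw [h2, ← h1, Measure.map_apply (innerSL ℝ u).continuous.measurable measurableSet_Icc]
  rw [Measure.real, h3, gaussianReal_apply _ one_ne_zero]
  apply ENNReal.toReal_le_of_le_ofReal hs
  calc ∫⁻ x in Set.Icc (-s) s, gaussianPDF 0 1 x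
      ≤ ∫⁻ x in Set.Icc (-s) s, ENNReal.ofReal (1/2) := by
        apply lintegral_mono
        intro x
        apply ENNReal.ofReal_le_ofReal
        rw [gaussianPDFReal]
        have e1 : rexp (-(x - 0) ^ 2 / (2 * ((1 : NNReal) : ℝ))) ≤ 1 := by
          apply Real.exp_le_one_iff.2
          simp only [NNReal.coe_one]
          nlinarith [sq_nonneg (x - 0)]
        have e2 : (2 : ℝ) ≤ √(2 * π * ((1 : NNReal) : ℝ)) := by
          apply Real.le_sqrt_of_sq_le
          simp only [NNReal.coe_one]
          nlinarith [Real.pi_gt_three]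
        have e3 : (√(2 * π * ((1 : NNReal) : ℝ)))⁻¹ ≤ 1/2 := by
          rw [one_div]
          exact inv_anti₀ (by norm_num) e2
        calc _ ≤ (1/2 : ℝ) * 1 := by gcongr
          _ = 1/2 := by ring
    _ = ENNReal.ofReal s := by
        rw [lintegral_const, Measure.restrict_apply_univ, Real.volume_Icc,
          ← ENNReal.ofReal_mul (by norm_num)]
        congr 1
        ring

open MeasureTheory ProbabilityTheory in
lemma aux_norm {d : ℕ} (hd : 0 < d) :
    (stdGaussian (EuclideanSpace ℝ (Fin d))).real {g | 4 * (d : ℝ) ≤ ‖g‖ ^ 2} ≤ 1 / 4 := by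
  set G := stdGaussian (EuclideanSpace ℝ (Fin d)) with hG
  have hL : ∀ i : Fin d, MemLp (fun g : EuclideanSpace ℝ (Fin d) => g i) 2 G := fun i =>
    IsGaussian.memLp_dual G (EuclideanSpace.proj i : EuclideanSpace ℝ (Fin d) →L[ℝ] ℝ) 2 (by simp)
  have hI : ∀ i : Fin d, ∫ g, (g i) ^ 2 ∂G = 1 := by
    intro i
    let L : StrongDual ℝ (EuclideanSpace ℝ (Fin d)) := innerSL ℝ (EuclideanSpace.single i (1:ℝ))
    have hLe : ∀ g, L g = g i := by
      intro g
      simp [L, EuclideanSpace.inner_single_left]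
    have hv := variance_dual_stdGaussian L
    rw [variance_of_integral_eq_zero L.continuous.aemeasurable
      (integral_strongDual_stdGaussian L)] at hv
    simp only [hLe] at hv
    rw [hG, hv]
    simp [L, innerSL_apply_norm]
  have hint : Integrable (fun g : EuclideanSpace ℝ (Fin d) => ‖g‖ ^ 2) G := by
    simp only [EuclideanSpace.real_norm_sq_eq]
    exact integrable_finsetSum _ fun i _ => (hL i).integrable_sq
  have hE : ∫ g, ‖g‖ ^ 2 ∂G = d := by
    simp only [EuclideanSpace.real_norm_sq_eq]
    rw [integral_finsetSum _ fun i _ => (hL i).integrable_sq]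
    simp [hI]
  have hM := mul_meas_ge_le_integral_of_nonneg (μ := G)
    (f := fun g : EuclideanSpace ℝ (Fin d) => ‖g‖ ^ 2)
    (Filter.Eventually.of_forall fun g => by positivity) hint (4 * (d : ℝ))
  rw [hE] at hM
  have hd' : (0 : ℝ) < d := by exact_mod_cast hd
  change 4 * (d : ℝ) * G.real {g | 4 * (d : ℝ) ≤ ‖g‖ ^ 2} ≤ d at hM
  by_contra h
  push Not at h
  nlinarith

open MeasureTheory ProbabilityTheory in
lemma aux_exists {d N : ℕ} (hd : 0 < d) (hN : 0 < N)
    (x : Fin N → EuclideanSpace ℝ (Fin d)) (hne : ∀ i j, i ≠ j → x i - x j ≠ 0) :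
    ∃ g : EuclideanSpace ℝ (Fin d), ‖g‖ ^ 2 ≤ 4 * d ∧
      ∀ i j, i ≠ j → 1 / (2 * (N : ℝ) ^ 2) * ‖x i - x j‖ ≤ |⟪g, x i - x j⟫| := by
  classical
  set G := stdGaussian (EuclideanSpace ℝ (Fin d)) with hG
  set s : ℝ := 1 / (2 * (N : ℝ) ^ 2) with hs
  have hN' : (0 : ℝ) < N := by exact_mod_cast hN
  have hs0 : 0 < s := by positivity
  let B : Fin N × Fin N → Set (EuclideanSpace ℝ (Fin d)) := fun p =>
    if p.1 ≠ p.2 then {g | |⟪(‖x p.1 - x p.2‖)⁻¹ • (x p.1 - x p.2), g⟫| ≤ s} else ∅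
  have hB : ∀ p, G.real (B p) ≤ s := by
    intro p
    by_cases hp : p.1 ≠ p.2
    · simp only [B, if_pos hp]
      refine aux_small _ ?_ s hs0.le
      exact norm_smul_inv_norm (𝕜 := ℝ) (hne _ _ hp)
    · simp only [B, if_neg hp]
      simpa using hs0.le
  have hU : G.real (⋃ p, B p) ≤ 1 / 2 := by
    calc _ ≤ ∑ p, G.real (B p) := measureReal_iUnion_fintype_le _
      _ ≤ ∑ p : Fin N × Fin N, s := Finset.sum_le_sum fun p _ => hB p
      _ = 1 / 2 := by
        simp [hs]
        field_simp
  have hT : G.real ({g | 4 * (d : ℝ) ≤ ‖g‖ ^ 2} ∪ ⋃ p, B p) < 1 := by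
    have := measureReal_union_le (μ := G) {g | 4 * (d : ℝ) ≤ ‖g‖ ^ 2} (⋃ p, B p)
    have := aux_norm hd
    linarith
  have : ∃ g, g ∉ ({g | 4 * (d : ℝ) ≤ ‖g‖ ^ 2} ∪ ⋃ p, B p) := by
    by_contra hc
    push Not at hc
    rw [Set.eq_univ_of_forall hc] at hT
    simp at hT
  obtain ⟨g, hg⟩ := this
  simp only [Set.mem_union, Set.mem_ofPred_eq, Set.mem_iUnion, not_or, not_le, not_exists] at hg
  refine ⟨g, hg.1.le, fun i j hij => ?_⟩
  have h := hg.2 (i, j)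
  simp only [B, if_pos hij, Set.mem_ofPred_eq, not_le, ne_eq] at h
  have hpos : 0 < ‖x i - x j‖ := norm_pos_iff.2 (hne i j hij)
  rw [real_inner_smul_left, abs_mul, abs_of_pos (inv_pos.2 hpos), real_inner_comm,
    lt_inv_mul_iff₀ hpos] at h
  linarith

/-- for (r,δ)-separated points x_1,…,x_N in ℝ^d there is a single ReLU
neuron F(x) = ReLU(wᵀx + b) with 0 ≤ F(x_i) ≤ 10rN²δ⁻¹√(πd) and
|F(x_i) − F(x_j)| ≥ 2 for i ≠ j. -/
theorem relu_neuron_separation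
    (d N : ℕ) (hd : 0 < d) (r δ : ℝ) (hr : 0 < r) (hδ : 0 < δ)
    (x : Fin N → EuclideanSpace ℝ (Fin d))
    (hnorm : ∀ i, ‖x i‖ ≤ r)
    (hsep : ∀ i j, i ≠ j → δ ≤ ‖x i - x j‖) :
    ∃ (w : EuclideanSpace ℝ (Fin d)) (b : ℝ),
      (∀ i, 0 ≤ max 0 (⟪w, x i⟫ + b) ∧
        max 0 (⟪w, x i⟫ + b) ≤ 10 * r * (N : ℝ) ^ 2 * δ⁻¹ * Real.sqrt (π * d)) ∧
      ∀ i j, i ≠ j → 2 ≤ |max 0 (⟪w, x i⟫ + b) - max 0 (⟪w, x j⟫ + b)| := by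
  rcases Nat.eq_zero_or_pos N with rfl | hN
  · exact ⟨0, 0, fun i => i.elim0, fun i => i.elim0⟩
  have hN' : (0 : ℝ) < N := by exact_mod_cast hN
  obtain ⟨g, hg, hgs⟩ := aux_exists hd hN x
    (fun i j hij => norm_pos_iff.1 (hδ.trans_le (hsep i j hij)))
  set c : ℝ := 4 * (N : ℝ) ^ 2 * δ⁻¹ with hc
  have hc0 : 0 < c := by positivity
  have hgn : ‖g‖ * 8 ≤ 10 * √(π * d) := by
    have h1 : (‖g‖ * (4 / 5)) ≤ √(π * d) := by
      apply Real.le_sqrt_of_sq_le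
      have : (0 : ℝ) ≤ d := by positivity
      nlinarith [Real.pi_gt_three]
    linarith
  have hin : ∀ i, |⟪c • g, x i⟫| ≤ c * (‖g‖ * r) := by
    intro i
    rw [real_inner_smul_left, abs_mul, abs_of_pos hc0]
    have := abs_real_inner_le_norm g (x i)
    have h2 := mul_le_mul_of_nonneg_left (hnorm i) (norm_nonneg g)
    gcongr
    linarith
  have hmax : ∀ i, max 0 (⟪c • g, x i⟫ + c * (‖g‖ * r)) = ⟪c • g, x i⟫ + c * (‖g‖ * r) := by
    intro i
    apply max_eq_right
    have := (abs_le.1 (hin i)).1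
    linarith
  refine ⟨c • g, c * (‖g‖ * r), fun i => ⟨le_max_left _ _, ?_⟩, fun i j hij => ?_⟩
  · rw [hmax]
    have h1 := (abs_le.1 (hin i)).2
    have h2 : c * (‖g‖ * r) + c * (‖g‖ * r) = (r * (N : ℝ) ^ 2 * δ⁻¹) * (‖g‖ * 8) := by
      rw [hc]; ring
    have h3 := mul_le_mul_of_nonneg_left hgn
      (show 0 ≤ r * (N : ℝ) ^ 2 * δ⁻¹ by positivity)
    linarith
  · rw [hmax, hmax]
    have h1 : ⟪c • g, x i⟫ + c * (‖g‖ * r) - (⟪c • g, x j⟫ + c * (‖g‖ * r))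
        = c * ⟪g, x i - x j⟫ := by
      rw [inner_sub_right, real_inner_smul_left, real_inner_smul_left]; ring
    rw [h1, abs_mul, abs_of_pos hc0]
    calc (2 : ℝ) = c * (1 / (2 * (N : ℝ) ^ 2) * δ) := by
          rw [hc]; field_simp; norm_num
      _ ≤ c * (1 / (2 * (N : ℝ) ^ 2) * ‖x i - x j‖) := by
          have := hsep i j hij
          gcongr
      _ ≤ _ := by
          have := hgs i j hij
          gcongr
end
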